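/- Every connected graph of diameter 3 without a universal line has at least as many distinct lines as vertices (i.e., graphs of diameter 3 satisfy the Chen–Chvátal conjecture). -/

import Mathlib

def graphLine {V : Type*} (G : SimpleGraph V) (x y : V) : Set V :=
  {x, y} ∪ {z | G.dist z y = G.dist z x + G.dist x y ∨
    G.dist x y = G.dist x z + G.dist z y ∨
    G.dist x z = G.dist x y + G.dist y z}

def graphLines {V : Type*} (G : SimpleGraph V) : Set (Set V) :=
  {l | ∃ x y : V, x ≠ y ∧ l = graphLine G x y}

namespace CC

structure Met {V : Type*} (d : V → V → ℕ) : Prop where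
  self : ∀ a, d a a = 0
  eq0 : ∀ a b, d a b = 0 → a = b
  symm : ∀ a b, d a b = d b a
  tri : ∀ a b c, d a c ≤ d a b + d b c
  le3 : ∀ a b, d a b ≤ 3
  step2 : ∀ a b, d a b = 2 → ∃ c, d a c = 1 ∧ d c b = 1
  step3 : ∀ a b, d a b = 3 → ∃ c, d a c = 2 ∧ d c b = 1

/-- The line generated by two points. -/
def L {V : Type*} (d : V → V → ℕ) (x y : V) : Set V :=
  {z | d z y = d z x + d x y ∨ d x y = d x z + d z y ∨ d x z = d x y + d y z}

variable {V : Type*} {d : V → V → ℕ}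

theorem mem_L {x y z : V} : z ∈ L d x y ↔
    (d z y = d z x + d x y ∨ d x y = d x z + d z y ∨ d x z = d x y + d y z) := Iff.rfl

theorem Met.t (M : Met d) (a b c : V) : d a b = d b a ∧ d a c = d c a ∧ d b c = d c b ∧
    d a b ≤ d a c + d b c ∧ d a c ≤ d a b + d b c ∧ d b c ≤ d a b + d a c ∧
    d a b ≤ 3 ∧ d a c ≤ 3 ∧ d b c ≤ 3 := by
  have h1 := M.symm a b
  have h2 := M.symm a c
  have h3 := M.symm b c
  have h4 := M.tri a b c
  have h5 := M.tri a c b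
  have h6 := M.tri b a c
  have := M.le3 a b
  have := M.le3 a c
  have := M.le3 b c
  omega

theorem ext_L {a b a' b' : V} (h : L d a b = L d a' b') (z : V) :
    (d z b = d z a + d a b ∨ d a b = d a z + d z b ∨ d a z = d a b + d b z) ↔
    (d z b' = d z a' + d a' b' ∨ d a' b' = d a' z + d z b' ∨ d a' z = d a' b' + d b' z) :=
  Set.ext_iff.1 h z

theorem L_comm (M : Met d) (a b : V) : L d a b = L d b a := by
  ext z
  simp only [mem_L]
  have := M.t a b z
  omega

/-- Two points at equal positive distance from `x` generating the same line with `x` coincide. -/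
theorem Met.N (M : Met d) {x z z' : V} (h2 : 2 ≤ d x z) (he : d x z = d x z')
    (h : L d x z = L d x z') : z = z' := by
  apply M.eq0
  have e := ext_L h z
  have := M.t x z z'
  have := M.self z
  omega

def Mt (d : V → V → ℕ) (x z w : V) : Prop := d x z = 2 ∧ d x w = 3 ∧ L d x z = L d x w

theorem Mt.adj (M : Met d) {x z w : V} (h : Mt d x z w) : d z w = 1 := by
  obtain ⟨h2, h3, h⟩ := h
  have e := ext_L h w
  have := M.t x z w
  have := M.self w
  omega

theorem Mt.u2 (M : Met d) {x z w : V} (h : Mt d x z w) {t : V} (ht : d x t = 2) (htw : d w t = 1) :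
    t = z := by
  obtain ⟨h2, h3, h⟩ := h
  apply M.eq0
  have e := ext_L h t
  have := M.t x z w
  have := M.t x z t
  have := M.t x t w
  omega

theorem Mt.u3 (M : Met d) {x z w : V} (h : Mt d x z w) {t : V} (ht : d x t = 3) (htw : d z t = 1) :
    t = w := by
  obtain ⟨h2, h3, h⟩ := h
  apply M.eq0
  have e := ext_L h t
  have := M.t x z w
  have := M.t x z t
  have := M.t x t w
  omega

theorem Mt.n1 (M : Met d) {x z w : V} (h : Mt d x z w) {t : V} (ht : d x t = 1) : d z t ≠ 3 := by
  intro h3'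
  have hh := h
  obtain ⟨h2, h3, h⟩ := h
  have e := ext_L h t
  have a1 := M.t x z w
  have a2 := M.t x z t
  have a3 := M.t x t w
  have : d t w = 2 := by omega
  obtain ⟨c, hc1, hc2⟩ := M.step2 _ _ this
  have a4 := M.t x t c
  have a5 := M.t x c w
  have : c = z := hh.u2 M (by omega) (by omega)
  subst this
  omega

theorem ncard_rel {α β : Type*} [Finite α] [Finite β] (S : Set α) (T : Set β) (R : α → β → Prop)
    (E : Finset β)
    (h1 : ∀ a ∈ S, ∃ b ∈ T, R a b) (h2 : ∀ a a' b, a ∈ S → a' ∈ S → R a b → R a' b → a = a')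
    (hE : ∀ b ∈ E, b ∈ T) (hE' : ∀ b ∈ E, ∀ a ∈ S, ¬ R a b) :
    S.ncard + E.card ≤ T.ncard := by
  classical
  rcases isEmpty_or_nonempty β with hb | hb
  · have hS : S = ∅ := by
      ext a
      simp only [Set.mem_empty_iff_false, iff_false]
      intro ha
      obtain ⟨b, _⟩ := h1 a ha
      exact hb.elim b
    have hE0 : E = ∅ := Finset.eq_empty_of_isEmpty E
    simp [hS, hE0]
  choose! f hf hR using h1
  have hinj : Set.InjOn f S := by
    intro a ha a' ha' e
    exact h2 a a' (f a) ha ha' (hR a ha) (e ▸ hR a' ha')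
  have hd : Disjoint (f '' S) (E : Set β) := by
    rw [Set.disjoint_left]
    rintro _ ⟨a, ha, rfl⟩ hb
    exact hE' _ hb a ha (hR a ha)
  have := Set.ncard_union_eq hd (Set.toFinite _) (Set.toFinite _)
  rw [Set.ncard_image_of_injOn hinj, Set.ncard_coe_finset] at this
  rw [← this]
  apply Set.ncard_le_ncard _ (Set.toFinite _)
  rintro b (⟨a, ha, rfl⟩ | hb)
  · exact hf a ha
  · exact hE b hb

/-- Inner lines: contain both or none of `x`, `y`, and some point strictly between them. -/
def Inner (d : V → V → ℕ) (x y : V) (l : Set V) : Prop :=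
  (x ∈ l ↔ y ∈ l) ∧ ∃ t ∈ l, d x t + d y t = 3 ∧ 1 ≤ d x t ∧ 1 ≤ d y t

theorem Inner.swap {x y : V} {l : Set V} (h : Inner d x y l) : Inner d y x l := by
  obtain ⟨h1, t, ht, h2⟩ := h
  exact ⟨h1.symm, t, ht, by omega⟩

theorem inner_comm {x y : V} {l : Set V} : Inner d x y l ↔ Inner d y x l :=
  ⟨Inner.swap, Inner.swap⟩

def Lines (d : V → V → ℕ) : Set (Set V) := {l | ∃ x y : V, x ≠ y ∧ l = L d x y}

theorem Lines.mk (M : Met d) {x y : V} (h : d x y ≠ 0) : L d x y ∈ Lines d :=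
  ⟨x, y, fun e => h (by rw [e]; exact M.self y), rfl⟩

def Out (d : V → V → ℕ) (x y : V) : Set V := {o | 4 ≤ d x o + d y o}

def NI (d : V → V → ℕ) (x y : V) : Set (Set V) := {l | l ∈ Lines d ∧ ¬ Inner d x y l}
def IL (d : V → V → ℕ) (x y : V) : Set (Set V) := {l | l ∈ Lines d ∧ Inner d x y l}

theorem NI_comm (x y : V) : NI d x y = NI d y x := by
  ext l; simp only [NI, Set.mem_ofPred_eq, inner_comm (x := x)]
theorem IL_comm (x y : V) : IL d x y = IL d y x := by
  ext l; simp only [IL, Set.mem_ofPred_eq, inner_comm (x := x)]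
theorem Out_comm (x y : V) : Out d x y = Out d y x := by
  ext l; simp only [Out, Set.mem_ofPred_eq, add_comm]

/-- A line through `x` and an outer point contains `x` and not `y`. -/
theorem xonly (M : Met d) {x y k : V} (hxy : d x y = 3) (hk : 4 ≤ d x k + d y k) :
    x ∈ L d x k ∧ y ∉ L d x k := by
  simp only [mem_L]
  have := M.t x y k
  have := M.self x
  omega

theorem xonly_NI (M : Met d) {x y k : V} (hxy : d x y = 3) (hk : 4 ≤ d x k + d y k) :
    L d x k ∈ NI d x y := by
  have := xonly M hxy hk
  have h2 := M.t x y k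
  refine ⟨Lines.mk M (by omega), fun h => ?_⟩
  have := h.1
  tauto

theorem yonly (M : Met d) {x y k : V} (hxy : d x y = 3) (hk : 4 ≤ d x k + d y k) :
    y ∈ L d y k ∧ x ∉ L d y k :=
  xonly M (M.symm x y ▸ hxy) (by omega)

theorem yonly_NI (M : Met d) {x y k : V} (hxy : d x y = 3) (hk : 4 ≤ d x k + d y k) :
    L d y k ∈ NI d x y := by
  rw [NI_comm]
  exact xonly_NI M (M.symm x y ▸ hxy) (by omega)

def KX (d : V → V → ℕ) (x y : V) (B C : V → Prop) (k o : V) : Prop :=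
  (d x k = 3 ∧ d y k = 1 ∧ k = o) ∨ (d x k = 2 ∧ d y k = 3 ∧ k = o) ∨
  (d x k = 2 ∧ d y k = 2 ∧ B k ∧ k = o) ∨ (d x k = 3 ∧ d y k = 3 ∧ C k ∧ k = o) ∨
  (d x k = 3 ∧ d y k = 2 ∧ d x o = 3 ∧ d y o = 3 ∧ Mt d y k o ∧
    ∀ s, d x s = 2 → d y s = 2 → ¬ Mt d x s k)

theorem KX_out {x y : V} {B C : V → Prop} {k o : V} (h : KX d x y B C k o) :
    4 ≤ d x k + d y k ∧ 2 ≤ d x k := by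
  unfold KX at h; omega

theorem KX_nomatch (M : Met d) {x y : V} {B C : V → Prop}
    (hB : ∀ z w, B z → Mt d x z w → d y w ≠ 1)
    (hBC : ∀ z w, B z → C w → ¬ Mt d x z w)
    (hC : ∀ z w, d y z = 3 → C w → ¬ Mt d x z w) {k o k' o' : V}
    (h : KX d x y B C k o) (h' : KX d x y B C k' o') (hm : Mt d x k k') : False := by
  have ha := hm.adj M
  have h2 := hm.1
  have h3 := hm.2.1
  have t := M.t y k k'
  have hy : d y k = 3 ∨ (d y k = 2 ∧ B k) := by
    rcases h with h | h | h | h | h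
    · omega
    · exact Or.inl h.2.1
    · exact Or.inr ⟨h.2.1, h.2.2.1⟩
    · omega
    · omega
  rcases h' with h' | h' | h' | h' | h'
  · rcases hy with hy | hy
    · omega
    · exact hB _ _ hy.2 hm h'.2.1
  · omega
  · omega
  · rcases hy with hy | hy
    · exact hC _ _ hy h'.2.2.1 hm
    · exact hBC _ _ hy.2 h'.2.2.1 hm
  · obtain ⟨_, h5, h6, h7, h8, h9⟩ := h'
    rcases hy with hy | hy
    · have : k = o' := h8.u3 M hy (by omega)
      subst this
      omega
    · exact h9 _ h2 hy.1 hm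

theorem KX_inj (M : Met d) {x y : V} {B C : V → Prop}
    (hB : ∀ z w, B z → Mt d x z w → d y w ≠ 1)
    (hBC : ∀ z w, B z → C w → ¬ Mt d x z w)
    (hC : ∀ z w, d y z = 3 → C w → ¬ Mt d x z w) {k o k' o' : V}
    (h : KX d x y B C k o) (h' : KX d x y B C k' o') (hL : L d x k = L d x k') : o = o' := by
  have hk := KX_out h
  have hk' := KX_out h'
  have t := M.t x k k'
  have : d x k = d x k' := by
    by_contra hne
    rcases (by omega : (d x k = 2 ∧ d x k' = 3) ∨ (d x k' = 2 ∧ d x k = 3)) with e | e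
    · exact KX_nomatch M hB hBC hC h h' ⟨e.1, e.2, hL⟩
    · exact KX_nomatch M hB hBC hC h' h ⟨e.1, e.2, hL.symm⟩
  have e := M.N hk.2 this hL
  subst e
  rcases h with h | h | h | h | h <;> rcases h' with h' | h' | h' | h' | h' <;>
    first
    | (exfalso; omega)
    | (have := h.2.2; have := h'.2.2; simp_all; done)
    | skip
  exact M.N (by omega) (by omega) (h.2.2.2.2.1.2.2.symm.trans h'.2.2.2.2.1.2.2)


end CC

namespace CC

section
variable {V : Type*} {d : V → V → ℕ}

def B1 (d : V → V → ℕ) (x y z : V) : Prop := d y z = 2 ∧ ∀ w, Mt d x z w → d y w ≠ 1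
def C1 (d : V → V → ℕ) (x y r : V) : Prop := ∀ z, Mt d x z r → d y z < 2
def B2 (d : V → V → ℕ) (x y z : V) : Prop :=
  d x z = 2 ∧ (∃ w, Mt d x z w ∧ d y w = 1) ∧ ∀ u, Mt d y z u → d x u ≠ 1
def C2 (d : V → V → ℕ) (x y r : V) : Prop :=
  (∀ z, Mt d y z r → d x z < 2) ∨
  (d x r = 3 ∧ d y r = 3 ∧ ∃ z, d x z = 2 ∧ d y z = 2 ∧ Mt d x z r ∧ Mt d y z r)

def RB (d : V → V → ℕ) (x y o : V) (l : Set V) : Prop :=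
  d x o = 2 ∧ d y o = 2 ∧ ∃ u w, Mt d x o w ∧ d y w = 1 ∧ Mt d y o u ∧ d x u = 1 ∧ l = L d u w

def RN (d : V → V → ℕ) (x y o : V) (l : Set V) : Prop :=
  d x o = 3 ∧ d y o = 3 ∧ ∃ z z', Mt d x z o ∧ d y z = 3 ∧ Mt d y z' o ∧ d x z' = 3 ∧
    (∃ s, d x s = 2 ∧ d y s = 2 ∧ Mt d y s z) ∧ (∃ s, d x s = 2 ∧ d y s = 2 ∧ Mt d x s z') ∧
    l = L d z z'

def RO (d : V → V → ℕ) (x y o : V) (l : Set V) : Prop :=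
  (∃ k, KX d x y (B1 d x y) (C1 d x y) k o ∧ l = L d x k) ∨
  (∃ k, KX d y x (B2 d x y) (C2 d x y) k o ∧ l = L d y k) ∨
  RB d x y o l ∨ RN d x y o l

theorem RB_spec (M : Met d) {x y o : V} {l : Set V} (hxy : d x y = 3) (h : RB d x y o l) :
    x ∈ l ∧ y ∈ l ∧ l ∈ NI d x y ∧ o ∈ l ∧ ∀ o', RB d x y o' l → o' = o := by
  obtain ⟨ho1, ho2, u, w, hw, hw1, hu, hu1, rfl⟩ := h
  have aw := hw.adj M
  have au := hu.adj M
  have bw := hw.2.1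
  have bu := hu.2.1
  have t1 := M.t x u w
  have t2 := M.t y u w
  have t3 := M.t o u w
  have hx : x ∈ L d u w := by rw [mem_L]; omega
  have hy : y ∈ L d u w := by rw [mem_L]; omega
  have key : ∀ t ∈ L d u w, d x t + d y t = 3 → 1 ≤ d x t → 1 ≤ d y t → False := by
    intro t ht h1 h2 h3
    rw [mem_L] at ht
    have s1 := M.t t u w
    have s2 := M.t x t u
    have s3 := M.t x t w
    have s4 := M.t y t u
    have s5 := M.t y t w
    have c1 : ¬ (d y t = 2 ∧ d u t = 1) := by
      rintro ⟨e1, e2⟩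
      have := hu.u2 M e1 e2
      subst this; omega
    have c2 : ¬ (d x t = 2 ∧ d w t = 1) := by
      rintro ⟨e1, e2⟩
      have := hw.u2 M e1 e2
      subst this; omega
    omega
  refine ⟨hx, hy, ⟨Lines.mk M (by omega), ?_⟩, by rw [mem_L]; omega, ?_⟩
  · rintro ⟨-, t, ht, h1, h2, h3⟩
    exact key t ht h1 h2 h3
  · rintro o' ⟨ho1', ho2', u', w', hw', hw1', hu', hu1', e⟩
    have s1 := M.t o' u' w'
    have aw' := hw'.adj M
    have au' := hu'.adj M
    have bw' := hw'.2.1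
    have bu' := hu'.2.1
    have t1' := M.t x u' w'
    have hh := (ext_L e o').2 (by omega)
    have s1 := M.t o' u w
    have s2 := M.t x o' u
    have s3 := M.t x o' w
    have s4 := M.t y o' u
    have s5 := M.t y o' w
    rcases (by omega : d u o' = 1 ∨ d w o' = 1) with g | g
    · exact hu.u2 M ho2' g
    · exact hw.u2 M ho1' g

theorem RN_spec (M : Met d) {x y o : V} {l : Set V} (hxy : d x y = 3) (h : RN d x y o l) :
    x ∉ l ∧ y ∉ l ∧ l ∈ NI d x y ∧ o ∈ l ∧ ∀ o', RN d x y o' l → o' = o := by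
  obtain ⟨ho1, ho2, z, z', hz, hz3, hz', hz3', ⟨s, hs1, hs2, hs⟩, ⟨s', hs1', hs2', hs'⟩, rfl⟩ := h
  have az := hz.adj M
  have az' := hz'.adj M
  have bz := hz.1
  have bz' := hz'.1
  have t1 := M.t x z z'
  have t2 := M.t y z z'
  have t3 := M.t o z z'
  have hne : d z z' ≠ 1 := by
    intro e
    have := hz.u3 M hz3' e
    subst this
    omega
  have hx : x ∉ L d z z' := by rw [mem_L]; omega
  have hy : y ∉ L d z z' := by rw [mem_L]; omega
  refine ⟨hx, hy, ⟨Lines.mk M (by omega), ?_⟩, by rw [mem_L]; omega, ?_⟩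
  · rintro ⟨-, t, ht, h1, h2, h3⟩
    rw [mem_L] at ht
    have s1 := M.t t z z'
    have s2 := M.t x t z
    have s3 := M.t x t z'
    have s4 := M.t y t z
    have s5 := M.t y t z'
    have c1 : ¬ (d y t = 2 ∧ d z t = 1) := by
      rintro ⟨e1, e2⟩
      have := hs.u2 M e1 e2
      subst this; omega
    have c2 : ¬ (d x t = 2 ∧ d z' t = 1) := by
      rintro ⟨e1, e2⟩
      have := hs'.u2 M e1 e2
      subst this; omega
    omega
  · rintro o' ⟨ho1', ho2', w, w', hw, hw3, hw', hw3', -, -, e⟩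
    have aw := hw.adj M
    have aw' := hw'.adj M
    have bw := hw.1
    have bw' := hw'.1
    have t1' := M.t x w w'
    have t2' := M.t y w w'
    have t3' := M.t o' w w'
    have hne' : d w w' ≠ 1 := by
      intro e
      have := hw.u3 M hw3' e
      subst this
      omega
    have hh := (ext_L e o').2 (by omega)
    have s1 := M.t o' z z'
    have s2 := M.t x o' z
    have s3 := M.t x o' z'
    have s4 := M.t y o' z
    have s5 := M.t y o' z'
    rcases (by omega : d z o' = 1 ∨ d z' o' = 1) with g | g
    · exact hz.u3 M ho1' g
    · exact hz'.u3 M ho2' g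

theorem RO_exists (M : Met d) {x y o : V} (hxy : d x y = 3) (ho : 4 ≤ d x o + d y o) :
    ∃ l ∈ NI d x y, RO d x y o l := by
  have hyx : d y x = 3 := M.symm x y ▸ hxy
  suffices h : ∃ l, RO d x y o l by
    obtain ⟨l, hl⟩ := h
    refine ⟨l, ?_, hl⟩
    rcases hl with ⟨k, hk, rfl⟩ | ⟨k, hk, rfl⟩ | h | h
    · exact xonly_NI M hxy (KX_out hk).1
    · rw [NI_comm]; exact xonly_NI M hyx (KX_out hk).1
    · exact (RB_spec M hxy h).2.2.1
    · exact (RN_spec M hxy h).2.2.1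
  have t := M.t x y o
  rcases (by omega : (d x o = 1 ∧ d y o = 3) ∨ (d x o = 3 ∧ d y o = 1) ∨ (d x o = 2 ∧ d y o = 3) ∨
    (d x o = 3 ∧ d y o = 2) ∨ (d x o = 2 ∧ d y o = 2) ∨ (d x o = 3 ∧ d y o = 3)) with
    h | h | h | h | h | h
  · exact ⟨_, Or.inr (Or.inl ⟨o, Or.inl ⟨h.2, h.1, rfl⟩, rfl⟩)⟩
  · exact ⟨_, Or.inl ⟨o, Or.inl ⟨h.1, h.2, rfl⟩, rfl⟩⟩
  · exact ⟨_, Or.inl ⟨o, Or.inr (Or.inl ⟨h.1, h.2, rfl⟩), rfl⟩⟩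
  · exact ⟨_, Or.inr (Or.inl ⟨o, Or.inr (Or.inl ⟨h.2, h.1, rfl⟩), rfl⟩)⟩
  · by_cases g : B1 d x y o
    · exact ⟨_, Or.inl ⟨o, Or.inr (Or.inr (Or.inl ⟨h.1, h.2, g, rfl⟩)), rfl⟩⟩
    by_cases g' : B2 d x y o
    · exact ⟨_, Or.inr (Or.inl ⟨o, Or.inr (Or.inr (Or.inl ⟨h.2, h.1, g', rfl⟩)), rfl⟩)⟩
    have hw : ∃ w, Mt d x o w ∧ d y w = 1 := by
      by_contra hc
      push Not at hc
      exact g ⟨h.2, hc⟩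
    have hu : ∃ u, Mt d y o u ∧ d x u = 1 := by
      by_contra hc
      push Not at hc
      exact g' ⟨h.1, hw, hc⟩
    obtain ⟨w, hw, hw1⟩ := hw
    obtain ⟨u, hu, hu1⟩ := hu
    exact ⟨_, Or.inr (Or.inr (Or.inl ⟨h.1, h.2, u, w, hw, hw1, hu, hu1, rfl⟩))⟩
  · by_cases g : C1 d x y o
    · exact ⟨_, Or.inl ⟨o, Or.inr (Or.inr (Or.inr (Or.inl ⟨h.1, h.2, g, rfl⟩))), rfl⟩⟩
    by_cases g' : C2 d x y o
    · exact ⟨_, Or.inr (Or.inl ⟨o, Or.inr (Or.inr (Or.inr (Or.inl ⟨h.2, h.1, g', rfl⟩))), rfl⟩)⟩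
    unfold C1 at g
    unfold C2 at g'
    push Not at g g'
    obtain ⟨z, hz, hz2⟩ := g
    obtain ⟨⟨z', hz', hz2'⟩, g'⟩ := g'
    have az := hz.adj M
    have az' := hz'.adj M
    have c1 : d y z = 3 := by
      by_contra hne
      have e : d y z = 2 := by have := M.le3 y z; omega
      have : z = z' := hz'.u2 M e (by rw [M.symm]; exact az)
      subst this
      exact g' h.1 h.2 z hz.1 e hz hz'
    have c2 : d x z' = 3 := by
      by_contra hne
      have e : d x z' = 2 := by have := M.le3 x z'; omega
      have : z' = z := hz.u2 M e (by rw [M.symm]; exact az')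
      subst this
      exact g' h.1 h.2 z' e hz'.1 hz hz'
    by_cases k1 : ∃ s, d x s = 2 ∧ d y s = 2 ∧ Mt d y s z
    · by_cases k2 : ∃ s, d x s = 2 ∧ d y s = 2 ∧ Mt d x s z'
      · exact ⟨_, Or.inr (Or.inr (Or.inr ⟨h.1, h.2, z, z', hz, c1, hz', c2, k1, k2, rfl⟩))⟩
      · push Not at k2
        exact ⟨_, Or.inl ⟨z', Or.inr (Or.inr (Or.inr (Or.inr
          ⟨c2, hz'.1, h.1, h.2, hz', k2⟩))), rfl⟩⟩
    · push Not at k1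
      exact ⟨_, Or.inr (Or.inl ⟨z, Or.inr (Or.inr (Or.inr (Or.inr
          ⟨c1, hz.1, h.2, h.1, hz, fun s e1 e2 => k1 s e2 e1⟩))), rfl⟩)⟩

theorem RO_inj (M : Met d) {x y o o' : V} {l : Set V} (hxy : d x y = 3)
    (h : RO d x y o l) (h' : RO d x y o' l) : o = o' := by
  have hyx : d y x = 3 := M.symm x y ▸ hxy
  have X : ∀ {o}, (∃ k, KX d x y (B1 d x y) (C1 d x y) k o ∧ l = L d x k) → x ∈ l ∧ y ∉ l := by
    rintro o ⟨k, hk, rfl⟩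
    exact xonly M hxy (KX_out hk).1
  have Y : ∀ {o}, (∃ k, KX d y x (B2 d x y) (C2 d x y) k o ∧ l = L d y k) → y ∈ l ∧ x ∉ l := by
    rintro o ⟨k, hk, rfl⟩
    exact xonly M hyx (KX_out hk).1
  have Z : ∀ {o}, RB d x y o l → x ∈ l ∧ y ∈ l := fun h =>
    ⟨(RB_spec M hxy h).1, (RB_spec M hxy h).2.1⟩
  have W : ∀ {o}, RN d x y o l → x ∉ l ∧ y ∉ l := fun h =>
    ⟨(RN_spec M hxy h).1, (RN_spec M hxy h).2.1⟩
  rcases h with h | h | h | h <;> rcases h' with h' | h' | h' | h'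
  · obtain ⟨k, hk, e⟩ := h
    obtain ⟨k', hk', e'⟩ := h'
    refine KX_inj M ?_ ?_ ?_ hk hk' (e.symm.trans e')
    · intro z w hz hm; exact hz.2 w hm
    · intro z w hz hw hm
      have := hw z hm
      have := hz.1
      omega
    · intro z w hz hw hm
      have := hw z hm
      omega
  · exact absurd (Y h').1 (X h).2
  · exact absurd (Z h').2 (X h).2
  · exact absurd (X h).1 (W h').1
  · exact absurd (X h').1 (Y h).2
  · obtain ⟨k, hk, e⟩ := h
    obtain ⟨k', hk', e'⟩ := h'
    refine KX_inj M ?_ ?_ ?_ hk hk' (e.symm.trans e')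
    · intro z w hz hm; exact hz.2.2 w hm
    · intro z r hz hr hm
      rcases hr with hr | ⟨hr1, hr2, z0, h1, h2, h3, h4⟩
      · have := hr z hm
        have := hz.1
        omega
      · have : z = z0 := h4.u2 M hm.1 (by rw [M.symm]; exact hm.adj M)
        subst this
        obtain ⟨-, ⟨w, hw, hw1⟩, -⟩ := hz
        have : w = r := h3.u3 M hw.2.1 (hw.adj M)
        subst this
        omega
    · intro z r hz hr hm
      rcases hr with hr | ⟨hr1, hr2, z0, h1, h2, h3, h4⟩
      · have := hr z hm
        omega
      · have : z = z0 := h4.u2 M hm.1 (by rw [M.symm]; exact hm.adj M)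
        subst this
        omega
  · exact absurd (Z h').1 (Y h).2
  · exact absurd (Y h).1 (W h').2
  · exact absurd (Z h).2 (X h').2
  · exact absurd (Z h).1 (Y h').2
  · exact (RB_spec M hxy h').2.2.2.2 o h
  · exact absurd (Z h).1 (W h').1
  · exact absurd (X h').1 (W h).1
  · exact absurd (Y h').1 (W h).2
  · exact absurd (Z h').1 (W h).1
  · exact (RN_spec M hxy h').2.2.2.2 o h

theorem outer [Finite V] (M : Met d) {x y : V} (hxy : d x y = 3) :
    (Out d x y).ncard ≤ (NI d x y).ncard := by
  have := ncard_rel (Out d x y) (NI d x y) (RO d x y) ∅ (fun o ho => RO_exists M hxy ho)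
    (fun o o' l _ _ h h' => RO_inj M hxy h h') (by simp) (by simp)
  simpa using this

end

end CC

namespace CC

section
variable {V : Type*} {d : V → V → ℕ}

def EA (d : V → V → ℕ) (x y : V) : Prop := ∀ o, 4 ≤ d x o + d y o → d x o = 3

def EC (d : V → V → ℕ) (x y : V) : Prop :=
  (∀ o, 4 ≤ d x o + d y o → d x o ≠ d y o) ∧
  ∀ v, d x v = 3 → d y v = 2 → ∃ q, d x q = 2 ∧ d y q = 1 ∧ d v q ≠ 2

def EE (d : V → V → ℕ) (x y : V) : Prop := EA d x y ∨ EA d y x ∨ EC d x y ∨ EC d y x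

theorem EE.swap {x y : V} (h : EE d x y) : EE d y x := by
  unfold EE at *; tauto

theorem outer_a [Finite V] (M : Met d) {x y : V} (hxy : d x y = 3)
    (hne : ∃ o, 4 ≤ d x o + d y o) (h : EA d x y) :
    (Out d x y).ncard + 1 ≤ (NI d x y).ncard := by
  obtain ⟨o0, ho0⟩ := hne
  refine ncard_rel (Out d x y) (NI d x y) (fun o l => l = L d x o) {L d y o0} ?_ ?_ ?_ ?_
  · intro o ho
    exact ⟨_, xonly_NI M hxy ho, rfl⟩
  · rintro o o' l ho ho' rfl e
    have h1 := h o ho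
    have h2 := h o' ho'
    exact M.N (by omega) (by omega) e
  · intro b hb
    rw [Finset.mem_singleton.1 hb]
    exact yonly_NI M hxy ho0
  · intro b hb o ho e
    rw [Finset.mem_singleton.1 hb] at e
    have h1 := xonly M hxy ho
    have h2 := yonly M hxy ho0
    rw [e] at h2
    tauto

def RC (d : V → V → ℕ) (x y o : V) (l : Set V) : Prop :=
  (((d x o = 3 ∧ d y o = 1) ∨ (d x o = 2 ∧ d y o = 3)) ∧ l = L d x o) ∨
  (((d x o = 1 ∧ d y o = 3) ∨ (d x o = 3 ∧ d y o = 2)) ∧ l = L d y o)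

theorem outer_c_of_extra [Finite V] (M : Met d) {x y : V} (hxy : d x y = 3) (h : EC d x y)
    (l : Set V) (hl : l ∈ NI d x y) (hl' : ∀ o, 4 ≤ d x o + d y o → ¬ RC d x y o l) :
    (Out d x y).ncard + 1 ≤ (NI d x y).ncard := by
  refine ncard_rel (Out d x y) (NI d x y) (RC d x y) {l} ?_ ?_ ?_ ?_
  · intro o ho
    have ho' : 4 ≤ d x o + d y o := ho
    have h1 : d x o ≠ d y o := h.1 o ho
    have t := M.t x y o
    rcases (by omega : ((d x o = 3 ∧ d y o = 1) ∨ (d x o = 2 ∧ d y o = 3)) ∨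
      ((d x o = 1 ∧ d y o = 3) ∨ (d x o = 3 ∧ d y o = 2))) with g | g
    · exact ⟨_, xonly_NI M hxy ho, Or.inl ⟨g, rfl⟩⟩
    · exact ⟨_, yonly_NI M hxy ho, Or.inr ⟨g, rfl⟩⟩
  · intro o o' l ho ho' h h'
    have nm : ∀ {x y z w}, d y z = 3 → d y w = 1 → ¬ Mt d x z w := by
      intro x y z w h1 h2 hm
      have := hm.adj M
      have := M.t y z w
      omega
    rcases h with ⟨h, e⟩ | ⟨h, e⟩ <;> rcases h' with ⟨h', e'⟩ | ⟨h', e'⟩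
    · have e2 := e.symm.trans e'
      rcases h with h | h <;> rcases h' with h' | h'
      · exact M.N (by omega) (by omega) e2
      · exact absurd ⟨h'.1, h.1, e2.symm⟩ (nm h'.2 h.2)
      · exact absurd ⟨h.1, h'.1, e2⟩ (nm h.2 h'.2)
      · exact M.N (by omega) (by omega) e2
    · have h1 := xonly M hxy ho
      have h2 := yonly M hxy ho'
      rw [← e] at h1
      rw [← e'] at h2
      tauto
    · have h1 := xonly M hxy ho'
      have h2 := yonly M hxy ho
      rw [← e'] at h1
      rw [← e] at h2
      tauto
    · have e2 := e.symm.trans e'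
      rcases h with h | h <;> rcases h' with h' | h'
      · exact M.N (by omega) (by omega) e2
      · exact absurd ⟨h'.2, h.2, e2.symm⟩ (nm h'.1 h.1)
      · exact absurd ⟨h.2, h'.2, e2⟩ (nm h.1 h'.1)
      · exact M.N (by omega) (by omega) e2
  · intro b hb
    rw [Finset.mem_singleton.1 hb]
    exact hl
  · intro b hb o ho
    rw [Finset.mem_singleton.1 hb]
    exact hl' o ho

theorem outer_c [Finite V] (M : Met d) {x y : V} (hxy : d x y = 3)
    (hne : ∃ o, 4 ≤ d x o + d y o) (h : EC d x y) :
    (Out d x y).ncard + 1 ≤ (NI d x y).ncard := by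
  have hyx : d y x = 3 := M.symm x y ▸ hxy
  -- extra line through `x`
  have X : ∀ v, 4 ≤ d x v + d y v →
      (∀ o, (d x o = 3 ∧ d y o = 1) ∨ (d x o = 2 ∧ d y o = 3) → L d x v = L d x o → False) →
      (Out d x y).ncard + 1 ≤ (NI d x y).ncard := by
    intro v hv hx
    refine outer_c_of_extra M hxy h (L d x v) (xonly_NI M hxy hv) ?_
    rintro o ho (⟨h1, e⟩ | ⟨h1, e⟩)
    · exact hx o h1 e
    · have h1 := xonly M hxy hv
      have h2 := yonly M hxy ho
      rw [← e] at h2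
      tauto
  have Y : ∀ v, 4 ≤ d x v + d y v →
      (∀ o, (d x o = 1 ∧ d y o = 3) ∨ (d x o = 3 ∧ d y o = 2) → L d y v = L d y o → False) →
      (Out d x y).ncard + 1 ≤ (NI d x y).ncard := by
    intro v hv hy
    refine outer_c_of_extra M hxy h (L d y v) (yonly_NI M hxy hv) ?_
    rintro o ho (⟨h1, e⟩ | ⟨h1, e⟩)
    · have h1 := yonly M hxy hv
      have h2 := xonly M hxy ho
      rw [← e] at h2
      tauto
    · exact hy o h1 e
  by_cases c1 : ∃ v, d x v = 3 ∧ d y v = 2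
  · obtain ⟨v, hv3, hv2⟩ := c1
    by_cases c2 : ∃ z, d y z = 3 ∧ Mt d x z v
    · obtain ⟨z, hz3, hz⟩ := c2
      obtain ⟨q, hq2, hq1, hq⟩ := h.2 v hv3 hv2
      have az := hz.adj M
      have bz := hz.1
      have hq3 : d v q = 3 := by
        have : d v q ≠ 1 := by
          intro e
          have := hz.u2 M hq2 e
          subst this; omega
        have : d v q ≠ 0 := by
          intro e
          have := M.eq0 _ _ e
          subst this; omega
        have := M.le3 v q
        omega
      refine Y z (by omega) ?_
      rintro o (ho | ho) e
      · have := M.N (by omega) (by omega) e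
        subst this; omega
      · have hm : Mt d y o z := ⟨ho.2, hz3, e.symm⟩
        have : o = v := hz.u3 M ho.1 (by rw [M.symm]; exact hm.adj M)
        subst this
        exact hm.n1 M hq1 hq3
    · refine X v (by omega) ?_
      rintro o (ho | ho) e
      · have := M.N (by omega) (by omega) e
        subst this; omega
      · exact c2 ⟨o, ho.2, ho.1, hv3, e.symm⟩
  by_cases c2 : ∃ v, d x v = 2 ∧ d y v = 3
  · obtain ⟨v, hv2, hv3⟩ := c2
    refine Y v (by omega) ?_
    rintro o (ho | ho) e
    · have := M.N (by omega) (by omega) e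
      subst this; omega
    · exact c1 ⟨o, ho⟩
  have ty : ∀ o, 4 ≤ d x o + d y o → (d x o = 1 ∧ d y o = 3) ∨ (d x o = 3 ∧ d y o = 1) := by
    intro o ho
    have h1 : d x o ≠ d y o := h.1 o ho
    have t := M.t x y o
    have h2 : ¬ (d x o = 3 ∧ d y o = 2) := fun g => c1 ⟨o, g⟩
    have h3 : ¬ (d x o = 2 ∧ d y o = 3) := fun g => c2 ⟨o, g⟩
    omega
  by_cases c3 : ∃ u, d x u = 1 ∧ d y u = 3
  · obtain ⟨u, hu1, hu3⟩ := c3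
    refine X u (by omega) ?_
    rintro w (hw | hw) e
    · have e1 := ext_L e w
      have t := M.t x u w
      have := M.self w
      have e2 : d u w = 2 := by omega
      obtain ⟨c, hc1, hc2⟩ := M.step2 _ _ e2
      have t1 := M.t x u c
      have t2 := M.t x c w
      have t3 := M.t y u c
      have := ty c
      omega
    · exact c2 ⟨w, hw⟩
  · refine outer_a M hxy hne ?_
    intro o ho
    rcases ty o ho with g | g
    · exact absurd ⟨o, g⟩ c3
    · exact g.1

theorem outer_plus [Finite V] (M : Met d) {x y : V} (hxy : d x y = 3)
    (hne : ∃ o, 4 ≤ d x o + d y o) (h : EE d x y) :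
    (Out d x y).ncard + 1 ≤ (NI d x y).ncard := by
  have hyx : d y x = 3 := M.symm x y ▸ hxy
  have hne' : ∃ o, 4 ≤ d y o + d x o := by
    obtain ⟨o, ho⟩ := hne
    exact ⟨o, by omega⟩
  rcases h with h | h | h | h
  · exact outer_a M hxy hne h
  · rw [Out_comm, NI_comm]; exact outer_a M hyx hne' h
  · exact outer_c M hxy hne h
  · rw [Out_comm, NI_comm]; exact outer_c M hyx hne' h

theorem EE_of_K (M : Met d) {x y : V} (hxy : d x y = 3)
    (h : ∀ o, 4 ≤ d x o + d y o → 2 ≤ d x o → 2 ≤ d y o → False) : EE d x y := by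
  refine Or.inr (Or.inr (Or.inl ⟨?_, ?_⟩))
  · intro o h1 h2
    exact h o h1 (by omega) (by omega)
  · intro v h1 h2
    exact (h v (by omega) (by omega) (by omega)).elim

end

end CC

namespace CC

section
variable {V : Type*} {d : V → V → ℕ}

/-- Neighbours of `x` on a shortest path from `x` to `y`. -/
def P (d : V → V → ℕ) (x y : V) : Set V := {p | d x p = 1 ∧ d y p = 2}

def Goal (d : V → V → ℕ) (x y : V) : Prop :=
  (P d x y).ncard + (P d y x).ncard + 2 ≤ (IL d x y).ncard ∨
  ((P d x y).ncard + (P d y x).ncard + 1 ≤ (IL d x y).ncard ∧ EE d x y)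

theorem Goal.swap {x y : V} (h : Goal d x y) : Goal d y x := by
  rcases h with h | h
  · left; rw [IL_comm]; omega
  · right; rw [IL_comm]; exact ⟨by omega, h.2.swap⟩

theorem I_mem (M : Met d) {x y : V} : x ∈ L d x y ∧ y ∈ L d x y := by
  have t := M.t x y x
  have := M.self x
  have := M.self y
  simp only [mem_L]
  omega

theorem I_P (M : Met d) {x y p : V} (hxy : d x y = 3) (hp : p ∈ P d x y) : p ∈ L d x y := by
  have t := M.t x y p
  have h1 := hp.1
  have h2 := hp.2
  simp only [mem_L]
  omega

theorem I_Q (M : Met d) {x y q : V} (hxy : d x y = 3) (hq : q ∈ P d y x) : q ∈ L d x y := by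
  rw [L_comm M]
  exact I_P M (M.symm x y ▸ hxy) hq

theorem I_out (M : Met d) {x y o : V} (hxy : d x y = 3) (ho : 4 ≤ d x o + d y o) : o ∉ L d x y := by
  have t := M.t x y o
  simp only [mem_L]
  omega

theorem mkIL (M : Met d) {x y a b t : V} (hab : d a b ≠ 0) (hx : x ∈ L d a b) (hy : y ∈ L d a b)
    (ht : t ∈ L d a b) (h : t ∈ P d x y ∨ t ∈ P d y x) : L d a b ∈ IL d x y := by
  refine ⟨Lines.mk M hab, iff_of_true hx hy, t, ht, ?_⟩
  rcases h with h | h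
  · have h1 := h.1
    have h2 := h.2
    omega
  · have h1 := h.1
    have h2 := h.2
    omega

theorem mkNL (M : Met d) {x y a b t : V} (hab : d a b ≠ 0) (hx : x ∉ L d a b) (hy : y ∉ L d a b)
    (ht : t ∈ L d a b) (h : t ∈ P d x y ∨ t ∈ P d y x) : L d a b ∈ IL d x y := by
  refine ⟨Lines.mk M hab, iff_of_false hx hy, t, ht, ?_⟩
  rcases h with h | h
  · have h1 := h.1
    have h2 := h.2
    omega
  · have h1 := h.1
    have h2 := h.2
    omega

theorem exP (M : Met d) {x y : V} (hxy : d x y = 3) : ∃ p, p ∈ P d x y := by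
  obtain ⟨c, h1, h2⟩ := M.step3 y x (M.symm x y ▸ hxy)
  exact ⟨c, by rw [M.symm]; exact h2, h1⟩

theorem I_IL (M : Met d) {x y : V} (hxy : d x y = 3) : L d x y ∈ IL d x y := by
  obtain ⟨p, hp⟩ := exP M hxy
  exact mkIL M (by omega) (I_mem M).1 (I_mem M).2 (I_P M hxy hp) (Or.inl hp)

theorem Lyp (M : Met d) {x y p : V} (hxy : d x y = 3) (hp : p ∈ P d x y) :
    x ∈ L d y p ∧ y ∈ L d y p ∧ p ∈ L d y p ∧ L d y p ∈ IL d x y := by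
  have t := M.t x y p
  have h1 := hp.1
  have h2 := hp.2
  have s1 := M.self x
  have s2 := M.self y
  have s3 := M.self p
  have a1 : x ∈ L d y p := by rw [mem_L]; omega
  have a2 : y ∈ L d y p := by rw [mem_L]; omega
  have a3 : p ∈ L d y p := by rw [mem_L]; omega
  exact ⟨a1, a2, a3, mkIL M (by omega) a1 a2 a3 (Or.inl hp)⟩

theorem Lxp (M : Met d) {x y p : V} (hxy : d x y = 3) (hp : p ∈ P d x y) :
    x ∈ L d x p ∧ y ∈ L d x p ∧ p ∈ L d x p ∧ L d x p ∈ IL d x y := by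
  have t := M.t x y p
  have h1 := hp.1
  have h2 := hp.2
  have s1 := M.self x
  have s2 := M.self y
  have s3 := M.self p
  have a1 : x ∈ L d x p := by rw [mem_L]; omega
  have a2 : y ∈ L d x p := by rw [mem_L]; omega
  have a3 : p ∈ L d x p := by rw [mem_L]; omega
  exact ⟨a1, a2, a3, mkIL M (by omega) a1 a2 a3 (Or.inl hp)⟩

theorem Lxq (M : Met d) {x y q : V} (hxy : d x y = 3) (hq : q ∈ P d y x) :
    x ∈ L d x q ∧ y ∈ L d x q ∧ q ∈ L d x q ∧ L d x q ∈ IL d x y := by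
  have := Lyp M (M.symm x y ▸ hxy) hq
  rw [IL_comm]; tauto

theorem Lyq (M : Met d) {x y q : V} (hxy : d x y = 3) (hq : q ∈ P d y x) :
    x ∈ L d y q ∧ y ∈ L d y q ∧ q ∈ L d y q ∧ L d y q ∈ IL d x y := by
  have := Lxp M (M.symm x y ▸ hxy) hq
  rw [IL_comm]; tauto

theorem LyP (M : Met d) {x y p p' : V} (hp : p ∈ P d x y) (hp' : p' ∈ P d x y)
    (h : p' ∈ L d y p) : p' = p := by
  apply M.eq0
  have t := M.t y p p'
  have t2 := M.t x p p'
  have h1 := hp.1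
  have h2 := hp.2
  have h3 := hp'.1
  have h4 := hp'.2
  rw [mem_L] at h
  omega

/-- Lines avoiding `x` and `y`. -/
theorem NL1 (M : Met d) {x y p p' : V} (hp : p ∈ P d x y) (hp' : p' ∈ P d x y)
    (h : d p p' = 1) : ∃ l ∈ IL d x y, x ∉ l ∧ y ∉ l := by
  have t := M.t y p p'
  have t2 := M.t x p p'
  have s3 := M.self p
  have h1 := hp.1
  have h2 := hp.2
  have h3 := hp'.1
  have h4 := hp'.2
  have a1 : x ∉ L d p p' := by rw [mem_L]; omega
  have a2 : y ∉ L d p p' := by rw [mem_L]; omega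
  have a3 : p ∈ L d p p' := by rw [mem_L]; omega
  exact ⟨_, mkNL M (by omega) a1 a2 a3 (Or.inl hp), a1, a2⟩

theorem NL2 (M : Met d) {x y p o : V} (hp : p ∈ P d x y) (ho1 : 2 ≤ d x o) (ho2 : 2 ≤ d y o)
    (h : d o p = d x o) : L d o p ∈ IL d x y ∧ x ∉ L d o p ∧ y ∉ L d o p := by
  have t := M.t y p o
  have t2 := M.t x p o
  have s3 := M.self p
  have h1 := hp.1
  have h2 := hp.2
  have a1 : x ∉ L d o p := by rw [mem_L]; omega
  have a2 : y ∉ L d o p := by rw [mem_L]; omega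
  have a3 : p ∈ L d o p := by rw [mem_L]; omega
  exact ⟨mkNL M (by omega) a1 a2 a3 (Or.inl hp), a1, a2⟩

/-- Consequences of the absence of inner lines avoiding `x` and `y`. -/
def NoN (d : V → V → ℕ) (x y : V) : Prop := ¬ ∃ l ∈ IL d x y, x ∉ l ∧ y ∉ l

theorem NoN.swap {x y : V} (h : NoN d x y) : NoN d y x := by
  rintro ⟨l, h1, h2, h3⟩
  rw [IL_comm] at h1
  exact h ⟨l, h1, h3, h2⟩

theorem NoN.pp (M : Met d) {x y p p' : V} (h : NoN d x y) (hp : p ∈ P d x y) (hp' : p' ∈ P d x y) :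
    p' ∈ L d x p := by
  have : d p p' ≠ 1 := fun e => h (NL1 M hp hp' e)
  have t2 := M.t x p p'
  have h1 := hp.1
  have h3 := hp'.1
  have h4 := M.self p
  by_cases e : d p p' = 0
  · have := M.eq0 _ _ e
    subst this
    rw [mem_L]; omega
  · rw [mem_L]; omega

theorem NoN.op (M : Met d) {x y p o : V} (h : NoN d x y) (hp : p ∈ P d x y) (ho1 : 2 ≤ d x o)
    (ho2 : 2 ≤ d y o) : o ∈ L d x p := by
  have : d o p ≠ d x o := fun e => h ⟨_, NL2 M hp ho1 ho2 e⟩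
  have t2 := M.t x p o
  have h1 := hp.1
  rw [mem_L]; omega

def Pf (d : V → V → ℕ) (x y p q : V) : Prop := p ∈ P d x y ∧ q ∈ P d y x ∧ L d y p = L d x q

theorem Pf.swap {x y p q : V} (h : Pf d x y p q) : Pf d y x q p := ⟨h.2.1, h.1, h.2.2.symm⟩

theorem Pf.oth (M : Met d) {x y p q q' : V} (h : Pf d x y p q) (hq' : q' ∈ P d y x)
    (hd : d p q' ≠ 2) : q' = q := by
  obtain ⟨hp, hq, e⟩ := h
  refine LyP M hq hq' ?_
  rw [← e, mem_L]
  have t := M.t y p q'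
  have t2 := M.t x p q'
  have h1 := hp.1
  have h2 := hp.2
  have h3 := hq'.1
  have h4 := hq'.2
  omega

theorem Pf.adj (M : Met d) {x y p q : V} (hxy : d x y = 3) (h : Pf d x y p q) : d p q = 1 := by
  obtain ⟨c, hc1, hc2⟩ := M.step2 _ _ h.1.2
  have t := M.t x y c
  have t2 := M.t x p c
  have h1 := h.1.1
  have : c = q := h.oth M (⟨hc1, by omega⟩ : c ∈ P d y x) (by have := M.t c p p; omega)
  subst this
  rw [M.symm]; exact hc2

theorem Pf.out (M : Met d) {x y p q o : V} (h : Pf d x y p q) (hxy : d x y = 3)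
    (ho : 4 ≤ d x o + d y o) : o ∉ L d x q := by
  intro h'
  have h2 := h'
  rw [← h.2.2, mem_L] at h2
  rw [mem_L] at h'
  have a := h.adj M hxy
  have h3 := h.1.1
  have h4 := h.1.2
  have h5 := h.2.1.1
  have h6 := h.2.1.2
  have t1 := M.t x p o
  have t2 := M.t y p o
  have t3 := M.t x q o
  have t4 := M.t y q o
  have t5 := M.t p q o
  omega

theorem Pf.xp (M : Met d) {x y p q q' : V} (h : Pf d x y p q) (hq' : q' ∈ P d y x)
    (hm : q' ∈ L d x p) : q' = q := by
  apply h.oth M hq'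
  rw [mem_L] at hm
  have h3 := h.1.1
  have h5 := hq'.2
  have t := M.t x p q'
  omega

theorem Pf.yq (M : Met d) {x y p q p' : V} (h : Pf d x y p q) (hp' : p' ∈ P d x y)
    (hm : p' ∈ L d y q) : p' = p := h.swap.xp M hp' hm

def Bad (d : V → V → ℕ) (x y p q : V) : Prop :=
  Pf d x y p q ∧ L d x p = L d x q ∧ L d y q = L d x q

theorem Bad.swap {x y p q : V} (h : Bad d x y p q) : Bad d y x q p :=
  ⟨h.1.swap, h.2.2.trans h.1.2.2.symm, h.2.1.trans h.1.2.2.symm⟩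

theorem Bad.op (M : Met d) {x y p q o : V} (hxy : d x y = 3) (h : Bad d x y p q)
    (ho : 4 ≤ d x o + d y o) : d o p = d x o := by
  have := h.1.out M hxy ho
  rw [← h.2.1, mem_L] at this
  have h3 := h.1.1.1
  have t := M.t x p o
  omega

theorem Bad.oq (M : Met d) {x y p q o : V} (hxy : d x y = 3) (h : Bad d x y p q)
    (ho : 4 ≤ d x o + d y o) : d o q = d y o :=
  h.swap.op M (M.symm x y ▸ hxy) (by omega)

theorem Bad.K (M : Met d) {x y p q o : V} (hxy : d x y = 3) (h : Bad d x y p q)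
    (ho : 4 ≤ d x o + d y o) : 2 ≤ d x o ∧ 2 ≤ d y o := by
  have h1 := h.op M hxy ho
  have h2 := h.oq M hxy ho
  have h3 := h.1.adj M hxy
  have t := M.t p q o
  have t2 := M.t x y o
  omega

theorem Bad.pp (M : Met d) {x y p q p' : V} (h : Bad d x y p q)
    (hp' : p' ∈ P d x y) (hne : p' ≠ p) : d p p' = 1 := by
  have : p' ∉ L d x p := by
    intro hm
    rw [h.2.1, ← h.1.2.2] at hm
    exact hne (LyP M h.1.1 hp' hm)
  rw [mem_L] at this
  have h3 := h.1.1.1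
  have h5 := hp'.1
  have t := M.t x p p'
  omega

/-- Assignment of lines to the points of `Q` in the main case. -/
def Ψ (d : V → V → ℕ) (x y o q : V) (l : Set V) : Prop :=
  ((¬ ∃ p, Pf d x y p q) ∧ l = L d x q) ∨
  (∃ p, Pf d x y p q ∧ L d x p ≠ L d x q ∧ l = L d x p) ∨
  (∃ p, Pf d x y p q ∧ L d x p = L d x q ∧ L d y q ≠ L d x q ∧ l = L d y q) ∨
  (∃ p, Bad d x y p q ∧ l = L d o p)

theorem Ψ_exists (M : Met d) {x y o q : V} (hxy : d x y = 3) (ho : 4 ≤ d x o + d y o)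
    (hq : q ∈ P d y x) : ∃ l ∈ IL d x y, Ψ d x y o q l := by
  by_cases h1 : ∃ p, Pf d x y p q
  · obtain ⟨p, hp⟩ := h1
    by_cases h2 : L d x p = L d x q
    · by_cases h3 : L d y q = L d x q
      · have hb : Bad d x y p q := ⟨hp, h2, h3⟩
        have hk := hb.K M hxy ho
        exact ⟨_, (NL2 M hp.1 hk.1 hk.2 (hb.op M hxy ho)).1,
          Or.inr (Or.inr (Or.inr ⟨p, hb, rfl⟩))⟩
      · exact ⟨_, (Lyq M hxy hq).2.2.2, Or.inr (Or.inr (Or.inl ⟨p, hp, h2, h3, rfl⟩))⟩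
    · exact ⟨_, (Lxp M hxy hp.1).2.2.2, Or.inr (Or.inl ⟨p, hp, h2, rfl⟩)⟩
  · exact ⟨_, (Lxq M hxy hq).2.2.2, Or.inl ⟨h1, rfl⟩⟩

/-- The first three kinds of lines, tagged. -/
def Ψ' (d : V → V → ℕ) (x y q : V) (l : Set V) : Prop :=
  x ∈ l ∧ q ∈ l ∧ ((∀ q' ∈ P d y x, q' ∈ l → q' = q) ∨
    ∃ p, Pf d x y p q ∧ p ∈ l ∧ ∀ p' ∈ P d x y, p' ∈ l → p' = p)

theorem Ψ'_of (M : Met d) {x y o q : V} {l : Set V} (hxy : d x y = 3) (hq : q ∈ P d y x)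
    (h : Ψ d x y o q l) : Ψ' d x y q l ∨ (∃ p, Bad d x y p q ∧ l = L d o p) := by
  rcases h with ⟨h, rfl⟩ | ⟨p, hp, h, rfl⟩ | ⟨p, hp, h1, h2, rfl⟩ | h
  · have := Lxq M hxy hq
    exact Or.inl ⟨this.1, this.2.2.1, Or.inl fun q' hq' hm => LyP M hq hq' hm⟩
  · have := Lxp M hxy hp.1
    refine Or.inl ⟨this.1, ?_, Or.inl fun q' hq' hm => hp.xp M hq' hm⟩
    have a := hp.adj M hxy
    have h3 := hp.1.1
    have h4 := hq.2
    rw [mem_L]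
    have t := M.t x p q
    omega
  · have := Lyq M hxy hq
    refine Or.inl ⟨this.1, this.2.2.1, Or.inr ⟨p, hp, ?_, fun p' hp' hm => hp.yq M hp' hm⟩⟩
    have a := hp.adj M hxy
    have h3 := hp.1.2
    have h4 := hq.1
    rw [mem_L]
    have t := M.t y p q
    omega
  · exact Or.inr h

theorem Ψ'_inj (M : Met d) {x y q q' : V} {l : Set V} (hq : q ∈ P d y x)
    (hq' : q' ∈ P d y x) (h : Ψ' d x y q l) (h' : Ψ' d x y q' l) : q = q' := by
  obtain ⟨-, h2, h3⟩ := h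
  obtain ⟨-, h2', h3'⟩ := h'
  rcases h3 with h3 | ⟨p, hp, hpl, h3⟩
  · exact (h3 q' hq' h2').symm
  rcases h3' with h3' | ⟨p', hp', hpl', h3'⟩
  · exact h3' q hq h2
  have e := h3 p' hp'.1 hpl'
  subst e
  exact LyP M hq' hq (by rw [← hp'.2.2, hp.2.2]; exact (by
    rw [mem_L]; have := M.self q; have := M.t x q q; omega))

theorem Ψ_inj (M : Met d) {x y o q q' : V} {l : Set V} (hxy : d x y = 3)
    (ho : 4 ≤ d x o + d y o) (hq : q ∈ P d y x)
    (hq' : q' ∈ P d y x) (h : Ψ d x y o q l) (h' : Ψ d x y o q' l) : q = q' := by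
  have N : ∀ {p q}, Bad d x y p q → x ∉ L d o p := by
    intro p q hb
    have hk := hb.K M hxy ho
    exact (NL2 M hb.1.1 hk.1 hk.2 (hb.op M hxy ho)).2.1
  rcases Ψ'_of M hxy hq h with g | ⟨p, hb, e⟩ <;> rcases Ψ'_of M hxy hq' h' with g' | ⟨p', hb', e'⟩
  · exact Ψ'_inj M hq hq' g g'
  · exact absurd (e' ▸ g.1) (N hb')
  · exact absurd (e ▸ g'.1) (N hb)
  · have hpp : p' = p := by
      by_contra hne
      have a := hb.pp M hb'.1.1 hne
      have h1 := hb.op M hxy ho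
      have h2 := hb'.op M hxy ho
      have h3 := hb.K M hxy ho
      have e2 := ext_L (e.symm.trans e') p'
      have := M.self p'
      have t := M.t o p p'
      omega
    subst hpp
    refine LyP M hq' hq ?_
    rw [← hb'.1.2.2, hb.1.2.2]
    exact (Lxq M hxy hq).2.2.1

def RI (d : V → V → ℕ) (x y o a : V) (l : Set V) : Prop :=
  (a ∈ P d x y ∧ l = L d y a) ∨ (a ∈ P d y x ∧ Ψ d x y o a l)

theorem RI_inj (M : Met d) {x y o a a' : V} {l : Set V} (hxy : d x y = 3)
    (ho : 4 ≤ d x o + d y o) (h : RI d x y o a l) (h' : RI d x y o a' l) : a = a' := by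
  have key : ∀ {p q}, p ∈ P d x y → q ∈ P d y x → l = L d y p → Ψ d x y o q l → False := by
    intro p q hp hq e h
    subst e
    have hl := Lyp M hxy hp
    rcases h with ⟨hn, e⟩ | ⟨p', hp', hn, e⟩ | ⟨p', hp', h1, h2, e⟩ | ⟨p', hb, e⟩
    · exact hn ⟨p, hp, hq, e⟩
    · have : p' = p := LyP M hp hp'.1 (by rw [e]; exact (Lxp M hxy hp'.1).2.2.1)
      subst this
      exact hn (e.symm.trans hp'.2.2)
    · have : p = p' := hp'.yq M hp (by rw [← e]; exact hl.2.2.1)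
      subst this
      exact h2 (e.symm.trans hp'.2.2)
    · have hk := hb.K M hxy ho
      exact (NL2 M hb.1.1 hk.1 hk.2 (hb.op M hxy ho)).2.1 (e ▸ hl.1)
  rcases h with ⟨h, e⟩ | ⟨h, e⟩ <;> rcases h' with ⟨h', e'⟩ | ⟨h', e'⟩
  · have h1 := h.2
    have h2 := h'.2
    exact M.N (by omega) (by omega) (e.symm.trans e')
  · exact (key h h' e e').elim
  · exact (key h' h e' e).elim
  · exact Ψ_inj M hxy ho h h' e e'

theorem PQ_card [Finite V] (x y : V) :
    (P d x y ∪ P d y x).ncard = (P d x y).ncard + (P d y x).ncard := by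
  apply Set.ncard_union_eq _ (Set.toFinite _) (Set.toFinite _)
  rw [Set.disjoint_left]
  intro a h1 h2
  have := h1.1
  have := h2.2
  omega

theorem RI_I (M : Met d) {x y o a : V} (hxy : d x y = 3) (ho : 4 ≤ d x o + d y o)
    (hP : ∀ p ∈ P d x y, ∃ p' ∈ P d x y, p' ≠ p) (hQ : ∀ q ∈ P d y x, ∃ q' ∈ P d y x, q' ≠ q) :
    ¬ RI d x y o a (L d x y) := by
  rintro (⟨h, e⟩ | ⟨h, e⟩)
  · obtain ⟨p', hp', hne⟩ := hP a h
    exact hne (LyP M h hp' (e ▸ I_P M hxy hp'))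
  · rcases Ψ'_of M hxy h e with ⟨-, -, g | ⟨p, hp, -, g⟩⟩ | ⟨p, hb, e⟩
    · obtain ⟨p', hp', hne⟩ := hQ a h
      exact hne (g _ hp' (I_Q M hxy hp'))
    · obtain ⟨p', hp', hne⟩ := hP p hp.1
      exact hne (g _ hp' (I_P M hxy hp'))
    · have hk := hb.K M hxy ho
      exact (NL2 M hb.1.1 hk.1 hk.2 (hb.op M hxy ho)).2.1 (e ▸ (I_mem M).1)

theorem count1 [Finite V] (M : Met d) {x y o : V} (hxy : d x y = 3) (ho : 4 ≤ d x o + d y o)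
    (hP : ∀ p ∈ P d x y, ∃ p' ∈ P d x y, p' ≠ p) (hQ : ∀ q ∈ P d y x, ∃ q' ∈ P d y x, q' ≠ q)
    (E : Finset (Set V)) (hE : ∀ l ∈ E, l ∈ IL d x y) (hE' : ∀ l ∈ E, ∀ a, ¬ RI d x y o a l) :
    (P d x y).ncard + (P d y x).ncard + E.card ≤ (IL d x y).ncard := by
  rw [← PQ_card]
  refine ncard_rel _ _ (RI d x y o) E ?_ ?_ hE (fun l hl a _ => hE' l hl a)
  · rintro a (h | h)
    · exact ⟨_, (Lyp M hxy h).2.2.2, Or.inl ⟨h, rfl⟩⟩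
    · obtain ⟨l, hl, h'⟩ := Ψ_exists M hxy ho h
      exact ⟨l, hl, Or.inr ⟨h, h'⟩⟩
  · intro a a' l _ _ h h'
    exact RI_inj M hxy ho h h'

theorem count_one [Finite V] (M : Met d) {x y o : V} (hxy : d x y = 3) (ho : 4 ≤ d x o + d y o)
    (hP : ∀ p ∈ P d x y, ∃ p' ∈ P d x y, p' ≠ p) (hQ : ∀ q ∈ P d y x, ∃ q' ∈ P d y x, q' ≠ q) :
    (P d x y).ncard + (P d y x).ncard + 1 ≤ (IL d x y).ncard := by
  have := count1 M hxy ho hP hQ {L d x y} (by simpa using I_IL M hxy)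
    (by simpa using fun a => RI_I M hxy ho hP hQ)
  simpa using this

theorem count_two [Finite V] (M : Met d) {x y o : V} (hxy : d x y = 3) (ho : 4 ≤ d x o + d y o)
    (hP : ∀ p ∈ P d x y, ∃ p' ∈ P d x y, p' ≠ p) (hQ : ∀ q ∈ P d y x, ∃ q' ∈ P d y x, q' ≠ q)
    {l : Set V} (hl : l ∈ IL d x y) (hlI : l ≠ L d x y) (hl' : ∀ a, ¬ RI d x y o a l) :
    Goal d x y := by
  classical
  have := count1 M hxy ho hP hQ {L d x y, l} (by simpa using ⟨I_IL M hxy, hl⟩)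
    (by simpa using ⟨fun a => RI_I M hxy ho hP hQ, hl'⟩)
  rw [Finset.card_pair hlI.symm] at this
  exact Or.inl this

end

end CC

namespace CC

section
variable {V : Type*} {d : V → V → ℕ}

theorem caseI [Finite V] (M : Met d) {x y : V} (hxy : d x y = 3)
    (hne : ∃ o, 4 ≤ d x o + d y o)
    (hP : ∀ p ∈ P d x y, ∃ p' ∈ P d x y, p' ≠ p) (hQ : ∀ q ∈ P d y x, ∃ q' ∈ P d y x, q' ≠ q) :
    Goal d x y := by
  have hyx : d y x = 3 := M.symm x y ▸ hxy
  by_cases c1 : ∃ p q, Bad d x y p q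
  · obtain ⟨p1, q1, hb⟩ := c1
    by_cases c2 : ∃ o, 4 ≤ d x o + d y o ∧ d x o = d y o
    · obtain ⟨o, ho, he⟩ := c2
      have hk := hb.K M hxy ho
      have hN := NL2 M hb.1.2.1 hk.2 hk.1 (hb.oq M hxy ho)
      rw [IL_comm] at hN
      refine count_two M hxy ho hP hQ hN.1 ?_ ?_
      · intro e
        exact hN.2.2 (e ▸ (I_mem M).1)
      · rintro a (⟨ha, e⟩ | ⟨ha, e⟩)
        · exact hN.2.2 (e ▸ (Lyp M hxy ha).1)
        · rcases Ψ'_of M hxy ha e with g | ⟨p, hb', e'⟩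
          · exact hN.2.2 g.1
          · have h1 := hb'.op M hxy ho
            have h2 := hb.oq M hxy ho
            have h3 := hb'.1.1.1
            have h4 := hb.1.2.1.2
            have t := M.t o p q1
            have t2 := M.t x p q1
            have := M.self q1
            have e2 := ext_L e' q1
            omega
    · push Not at c2
      obtain ⟨o, ho⟩ := hne
      refine Or.inr ⟨count_one M hxy ho hP hQ, Or.inr (Or.inr (Or.inl ⟨c2, ?_⟩))⟩
      intro v hv1 hv2
      obtain ⟨c, hc1, hc2⟩ := M.step2 _ _ hv2
      have t := M.t x y c
      have t2 := M.t x c v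
      have t3 := M.t v c c
      refine ⟨c, ?_, hc1, by omega⟩
      have : ¬ d x c = 3 := by
        intro e
        have := hb.K M hxy (o := c) (by omega)
        omega
      omega
  obtain ⟨o, ho⟩ := hne
  by_cases hN : ∃ l ∈ IL d x y, x ∉ l ∧ y ∉ l
  · obtain ⟨l, hl, hlx, hly⟩ := hN
    refine count_two M hxy ho hP hQ hl ?_ ?_
    · rintro rfl
      exact hlx (I_mem M).1
    · rintro a (⟨ha, rfl⟩ | ⟨ha, e⟩)
      · exact hlx (Lyp M hxy ha).1
      · rcases Ψ'_of M hxy ha e with g | ⟨p, hb', e'⟩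
        · exact hlx g.1
        · exact c1 ⟨_, _, hb'⟩
  have hN : NoN d x y := hN
  by_cases c2 : ∃ p q, Pf d x y p q
  · obtain ⟨p1, q1, hp⟩ := c2
    obtain ⟨p', hp', hpne⟩ := hP p1 hp.1
    obtain ⟨q', hq', hqne⟩ := hQ q1 hp.2.1
    have hq'm : ∀ q ∈ P d y x, q ∈ L d y q1 := fun q hq => hN.swap.pp M hp.2.1 hq
    refine count_two M hxy ho hP hQ (Lyq M hxy hp.2.1).2.2.2 ?_ ?_
    · intro e
      exact hpne (hp.yq M hp' (e ▸ I_P M hxy hp'))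
    · rintro a (⟨ha, e⟩ | ⟨ha, e⟩)
      · have : a = p1 := hp.yq M ha (e ▸ (Lyp M hxy ha).2.2.1)
        subst this
        refine hqne (LyP M hp.2.1 hq' ?_)
        rw [← hp.2.2, ← e]
        exact hq'm _ hq'
      · have : ∀ q ∈ P d y x, ¬ ∀ q' ∈ P d y x, q' ∈ L d y q1 → q' = q := by
          intro q hq hall
          have e1 := hall q1 hp.2.1 (hq'm _ hp.2.1)
          have e2 := hall q' hq' (hq'm _ hq')
          exact hqne (e2.trans e1.symm)
        rcases e with ⟨h, e⟩ | ⟨p, hp2, h, e⟩ | ⟨p, hp2, h1, h2, e⟩ | ⟨p, hb', e⟩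
        · apply this a ha
          intro q'' h'' hm
          exact LyP M ha h'' (e ▸ hm)
        · apply this a ha
          intro q'' h'' hm
          exact hp2.xp M h'' (e ▸ hm)
        · obtain ⟨p3, hp3, hne3⟩ := hP p hp2.1
          refine hne3 (LyP M hp2.1 hp3 ?_)
          rw [hp2.2.2, ← h1]
          exact hN.pp M hp2.1 hp3
        · exact c1 ⟨_, _, hb'⟩
  by_cases hK : ∃ o, 2 ≤ d x o ∧ 2 ≤ d y o
  · obtain ⟨k, hk1, hk2⟩ := hK
    obtain ⟨p, hp⟩ := exP M hxy
    obtain ⟨q, hq⟩ := exP M hyx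
    have hRI : ∀ a l, RI d x y o a l → (a ∈ P d x y ∧ l = L d y a) ∨ (a ∈ P d y x ∧ l = L d x a) := by
      rintro a l (⟨ha, e⟩ | ⟨ha, e⟩)
      · exact Or.inl ⟨ha, e⟩
      · rcases e with ⟨h, e⟩ | ⟨p, hp2, h, e⟩ | ⟨p, hp2, h1, h2, e⟩ | ⟨p, hb', e⟩
        · exact Or.inr ⟨ha, e⟩
        · exact absurd ⟨_, _, hp2⟩ c2
        · exact absurd ⟨_, _, hp2⟩ c2
        · exact absurd ⟨_, _, hb'.1⟩ c2
    by_cases g1 : ∃ q' ∈ P d y x, L d x p = L d x q'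
    · by_cases g2 : ∃ p' ∈ P d x y, L d y q = L d y p'
      · exfalso
        obtain ⟨q', hq', e1⟩ := g1
        obtain ⟨p', hp', e2⟩ := g2
        have m1 := hN.op M hp hk1 hk2
        have m2 := hN.swap.op M hq hk2 hk1
        rw [e1, mem_L] at m1
        rw [e2, mem_L] at m2
        have f1 := hq'.1
        have f2 := hq'.2
        have f3 := hp'.1
        have f4 := hp'.2
        have t1 := M.t x k q'
        have t2 := M.t y k q'
        have t3 := M.t x k p'
        have t4 := M.t y k p'
        omega
      · refine count_two M hxy ho hP hQ (Lyq M hxy hq).2.2.2 ?_ ?_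
        · intro e
          have m2 := hN.swap.op M hq hk2 hk1
          exact I_out M hxy (by omega) (e ▸ m2)
        · intro a ha
          rcases hRI _ _ ha with ⟨ha, e⟩ | ⟨ha, e⟩
          · exact g2 ⟨a, ha, e⟩
          · obtain ⟨q2, hq2, hn⟩ := hQ a ha
            exact hn (LyP M ha hq2 (e ▸ hN.swap.pp M hq hq2))
    · refine count_two M hxy ho hP hQ (Lxp M hxy hp).2.2.2 ?_ ?_
      · intro e
        have m2 := hN.op M hp hk1 hk2
        exact I_out M hxy (by omega) (e ▸ m2)
      · intro a ha
        rcases hRI _ _ ha with ⟨ha, e⟩ | ⟨ha, e⟩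
        · obtain ⟨q2, hq2, hn⟩ := hP a ha
          exact hn (LyP M ha hq2 (e ▸ hN.pp M hp hq2))
        · exact g1 ⟨a, ha, e⟩
  · refine Or.inr ⟨count_one M hxy ho hP hQ, EE_of_K M hxy ?_⟩
    intro k _ h1 h2
    exact hK ⟨k, h1, h2⟩

/-- If `P` consists of `p` only then `p` is adjacent to all of `Q`. -/
theorem single_adj (M : Met d) {x y p q : V} (hxy : d x y = 3)
    (hp1 : ∀ p' ∈ P d x y, p' = p) (hq : q ∈ P d y x) : d p q = 1 := by
  obtain ⟨c, hc1, hc2⟩ := M.step2 _ _ hq.2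
  have h1 := hq.1
  have t := M.t y c q
  have t2 := M.t x y c
  have := hp1 c ⟨hc1, by omega⟩
  subst this
  exact hc2

theorem cover (M : Met d) {x y p q : V} (hxy : d x y = 3) (hp : p ∈ P d x y) (hq : q ∈ P d y x)
    {S : Set V} (hx : x ∈ S) (hy : y ∈ S) (hSP : ∀ p ∈ P d x y, p ∈ S) (hSQ : ∀ p ∈ P d y x, p ∈ S)
    (hO : ∀ o, 4 ≤ d x o + d y o → o ∈ S) (z : V) : z ∈ S := by
  have t := M.t x y z
  by_cases h0 : d x z = 0
  · exact M.eq0 _ _ h0 ▸ hx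
  by_cases h1 : d y z = 0
  · exact M.eq0 _ _ h1 ▸ hy
  by_cases h2 : 4 ≤ d x z + d y z
  · exact hO z h2
  by_cases h3 : d x z = 1
  · exact hSP z ⟨h3, by omega⟩
  · exact hSQ z ⟨by omega, by omega⟩

theorem universal_of_eq (M : Met d) {x y p q : V} (hxy : d x y = 3) (hp : p ∈ P d x y)
    (hq : q ∈ P d y x) (hpq : d p q = 1) (hN : NoN d x y) (e : L d x p = L d y q) (z : V) :
    z ∈ L d x p := by
  have h := Lxp M hxy hp
  have f1 := hp.1
  have f2 := hp.2
  have f3 := hq.1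
  have f4 := hq.2
  refine cover M hxy hp hq h.1 h.2.1 (fun p' hp' => hN.pp M hp hp')
    (fun q' hq' => e ▸ hN.swap.pp M hq hq') ?_ z
  intro o ho
  by_cases hk : 2 ≤ d x o ∧ 2 ≤ d y o
  · exact hN.op M hp hk.1 hk.2
  have e2 := ext_L e o
  rw [mem_L]
  have t := M.t x y o
  have t1 := M.t x p o
  have t2 := M.t y q o
  have t3 := M.t p q o
  have t4 := M.t y p o
  have t5 := M.t x q o
  omega

theorem count2 [Finite V] (M : Met d) {x y : V} (hxy : d x y = 3)
    (hQ : ∀ q ∈ P d y x, ∃ q' ∈ P d y x, q' ≠ q)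
    (E : Finset (Set V)) (hE : ∀ l ∈ E, l ∈ IL d x y)
    (hE' : ∀ l ∈ E, x ∉ l ∨ ∀ q ∈ P d y x, q ∈ l) :
    (P d y x).ncard + E.card ≤ (IL d x y).ncard := by
  refine ncard_rel _ _ (fun q l => l = L d x q) E ?_ ?_ hE ?_
  · intro q hq
    exact ⟨_, (Lxq M hxy hq).2.2.2, rfl⟩
  · rintro q q' l hq hq' rfl e
    have h1 := hq.2
    have h2 := hq'.2
    exact M.N (by omega) (by omega) e
  · rintro l hl q hq rfl
    rcases hE' _ hl with h | h
    · exact h (Lxq M hxy hq).1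
    · obtain ⟨q', hq', hne⟩ := hQ q hq
      exact hne (LyP M hq hq' (h q' hq'))

theorem caseII [Finite V] (M : Met d) {x y : V} (hxy : d x y = 3)
    (hu : ∀ a b, d a b ≠ 0 → ∃ z, z ∉ L d a b)
    (hne : ∃ o, 4 ≤ d x o + d y o) {p : V} (hp : p ∈ P d x y)
    (hP : ∀ p' ∈ P d x y, p' = p) (hQ : ∀ q ∈ P d y x, ∃ q' ∈ P d y x, q' ≠ q) :
    Goal d x y := by
  classical
  have hyx : d y x = 3 := M.symm x y ▸ hxy
  have hPc : (P d x y).ncard = 1 := by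
    rw [Set.ncard_eq_one]
    exact ⟨p, Set.eq_singleton_iff_unique_mem.2 ⟨hp, hP⟩⟩
  have f1 := hp.1
  have f2 := hp.2
  have lx := Lxp M hxy hp
  have ly := Lyp M hxy hp
  have adj : ∀ q ∈ P d y x, d p q = 1 := fun q hq => single_adj M hxy hP hq
  have Qx : ∀ q ∈ P d y x, q ∈ L d x p := by
    intro q hq
    have h1 := hq.2
    have h2 := adj q hq
    have t := M.t x p q
    rw [mem_L]; omega
  have Qy : ∀ q ∈ P d y x, q ∈ L d y p := by
    intro q hq
    have h1 := hq.1
    have h2 := adj q hq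
    have t := M.t y p q
    rw [mem_L]; omega
  have QI : ∀ q ∈ P d y x, q ∈ L d x y := fun q hq => I_Q M hxy hq
  have hI := I_IL M hxy
  have C3 : ∀ l1 l2, l1 ∈ IL d x y → l2 ∈ IL d x y → (x ∉ l1 ∨ ∀ q ∈ P d y x, q ∈ l1) →
      (x ∉ l2 ∨ ∀ q ∈ P d y x, q ∈ l2) → L d x y ≠ l1 → L d x y ≠ l2 → l1 ≠ l2 → Goal d x y := by
    intro l1 l2 h1 h2 g1 g2 n1 n2 n3
    have := count2 M hxy hQ {L d x y, l1, l2} (by simp [*]) (by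
      intro l hl
      simp only [Finset.mem_insert, Finset.mem_singleton] at hl
      rcases hl with rfl | rfl | rfl
      · exact Or.inr QI
      · exact g1
      · exact g2)
    rw [Finset.card_eq_three.2 ⟨_, _, _, n1, n2, n3, rfl⟩] at this
    left; omega
  have C2 : ∀ l1, l1 ∈ IL d x y → (x ∉ l1 ∨ ∀ q ∈ P d y x, q ∈ l1) →
      L d x y ≠ l1 → EE d x y → Goal d x y := by
    intro l1 h1 g1 n1 hE
    have := count2 M hxy hQ {L d x y, l1} (by simp [*]) (by
      intro l hl
      simp only [Finset.mem_insert, Finset.mem_singleton] at hl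
      rcases hl with rfl | rfl
      · exact Or.inr QI
      · exact g1)
    rw [Finset.card_pair n1] at this
    right; exact ⟨by omega, hE⟩
  by_cases cc : L d x y = L d x p ∧ L d x y = L d y p
  · obtain ⟨e1, e2⟩ := cc
    have dat : ∀ o, 4 ≤ d x o + d y o → d o p = d x o ∧ 2 ≤ d x o ∧ 2 ≤ d y o := by
      intro o ho
      have m1 := I_out M hxy ho
      have m2 := m1
      rw [e1, mem_L] at m1
      rw [e2, mem_L] at m2
      have t1 := M.t x p o
      have t2 := M.t y p o
      have t3 := M.t x y o
      omega
    have hE : EA d x y := by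
      intro o ho
      by_contra hn
      have h1 := dat o ho
      have t := M.t x p o
      obtain ⟨c, hc1, hc2⟩ := M.step2 x o (by omega)
      have h2 := dat c
      have t2 := M.t x y c
      have : c = p := hP c ⟨hc1, by omega⟩
      subst this
      have t3 := M.t c o o
      omega
    obtain ⟨o, ho⟩ := hne
    have h1 := dat o ho
    have hN := NL2 M hp h1.2.1 h1.2.2 h1.1
    refine C2 _ hN.1 (Or.inl hN.2.1) ?_ (Or.inl hE)
    intro e
    exact hN.2.1 (e ▸ (I_mem M).1)
  by_cases hE : EE d x y
  · by_cases g : L d x y = L d x p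
    · exact C2 _ ly.2.2.2 (Or.inr Qy) (fun e => cc ⟨g, e⟩) hE
    · exact C2 _ lx.2.2.2 (Or.inr Qx) g hE
  by_cases hN : ∃ l ∈ IL d x y, x ∉ l ∧ y ∉ l
  · obtain ⟨l, hl, hlx, hly⟩ := hN
    have n1 : L d x y ≠ l := by
      rintro rfl
      exact hlx (I_mem M).1
    by_cases g : L d x y = L d x p
    · refine C3 _ l ly.2.2.2 hl (Or.inr Qy) (Or.inl hlx) (fun e => cc ⟨g, e⟩) n1 ?_
      rintro rfl
      exact hlx ly.1
    · refine C3 _ l lx.2.2.2 hl (Or.inr Qx) (Or.inl hlx) g n1 ?_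
      rintro rfl
      exact hlx lx.1
  have hN : NoN d x y := hN
  have hK : ∃ o, 4 ≤ d x o + d y o ∧ 2 ≤ d x o ∧ 2 ≤ d y o := by
    by_contra hc
    push Not at hc
    refine hE (EE_of_K M hxy ?_)
    intro o h1 h2 h3
    have := hc o h1 h2
    omega
  obtain ⟨o, ho, ho1, ho2⟩ := hK
  obtain ⟨q, hq⟩ := exP M hyx
  have lq := Lyq M hxy hq
  have mo := I_out M hxy ho
  refine C3 (L d x p) (L d y q) lx.2.2.2 lq.2.2.2 (Or.inr Qx)
    (Or.inr fun q' hq' => hN.swap.pp M hq hq') ?_ ?_ ?_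
  · intro e
    exact mo (e ▸ hN.op M hp ho1 ho2)
  · intro e
    exact mo (e ▸ hN.swap.op M hq ho2 ho1)
  · intro e
    obtain ⟨z, hz⟩ := hu x p (by omega)
    exact hz (universal_of_eq M hxy hp hq (adj q hq) hN e z)

end

end CC

namespace CC

section
variable {V : Type*} {d : V → V → ℕ}

theorem caseIII [Finite V] (M : Met d) {x y : V} (hxy : d x y = 3)
    (hu : ∀ a b, d a b ≠ 0 → ∃ z, z ∉ L d a b)
    (hne : ∃ o, 4 ≤ d x o + d y o) {p q : V} (hp : p ∈ P d x y)
    (hP : ∀ p' ∈ P d x y, p' = p) (hq : q ∈ P d y x) (hQ : ∀ q' ∈ P d y x, q' = q) :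
    Goal d x y := by
  classical
  have hyx : d y x = 3 := M.symm x y ▸ hxy
  have hPc : (P d x y).ncard = 1 := by
    rw [Set.ncard_eq_one]
    exact ⟨p, Set.eq_singleton_iff_unique_mem.2 ⟨hp, hP⟩⟩
  have hQc : (P d y x).ncard = 1 := by
    rw [Set.ncard_eq_one]
    exact ⟨q, Set.eq_singleton_iff_unique_mem.2 ⟨hq, hQ⟩⟩
  have f1 := hp.1
  have f2 := hp.2
  have f3 := hq.1
  have f4 := hq.2
  have adj : d p q = 1 := single_adj M hxy hP hq
  have cnt : ∀ E : Finset (Set V), (∀ l ∈ E, l ∈ IL d x y) → E.card ≤ (IL d x y).ncard := by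
    intro E hE
    rw [← Set.ncard_coe_finset]
    exact Set.ncard_le_ncard hE (Set.toFinite _)
  have hI := I_IL M hxy
  have C3 : ∀ l1 l2 l3, l1 ∈ IL d x y → l2 ∈ IL d x y → l3 ∈ IL d x y → l1 ≠ l2 → l1 ≠ l3 →
      l2 ≠ l3 → EE d x y → Goal d x y := by
    intro l1 l2 l3 h1 h2 h3 n1 n2 n3 hE
    have := cnt {l1, l2, l3} (by simp [*])
    rw [Finset.card_eq_three.2 ⟨_, _, _, n1, n2, n3, rfl⟩] at this
    right; exact ⟨by omega, hE⟩
  have C4 : ∀ l1 l2 l3 l4, l1 ∈ IL d x y → l2 ∈ IL d x y → l3 ∈ IL d x y → l4 ∈ IL d x y →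
      l1 ≠ l2 → l1 ≠ l3 → l2 ≠ l3 → l1 ≠ l4 → l2 ≠ l4 → l3 ≠ l4 → Goal d x y := by
    intro l1 l2 l3 l4 h1 h2 h3 h4 n1 n2 n3 n4 n5 n6
    have := cnt {l4, l1, l2, l3} (by simp [*])
    rw [Finset.card_insert_of_notMem (by simp [n4.symm, n5.symm, n6.symm]),
      Finset.card_eq_three.2 ⟨_, _, _, n1, n2, n3, rfl⟩] at this
    left; omega
  have l1 := Lxp M hxy hp
  have l2 := Lyq M hxy hq
  have sx := M.self x
  have sy := M.self y
  have sp := M.self p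
  have sq := M.self q
  have t1 := M.t x p q
  have t2 := M.t y p q
  have l3x : x ∈ L d p q := by rw [mem_L]; omega
  have l3y : y ∈ L d p q := by rw [mem_L]; omega
  have l3p : p ∈ L d p q := by rw [mem_L]; omega
  have l3q : q ∈ L d p q := by rw [mem_L]; omega
  have l3 : L d p q ∈ IL d x y := mkIL M (by omega) l3x l3y l3p (Or.inl hp)
  have l1q : q ∈ L d x p := by rw [mem_L]; omega
  have l2p : p ∈ L d y q := by rw [mem_L]; omega
  have m1 : ∀ o, 4 ≤ d x o + d y o → (o ∉ L d x p ↔ d o p = d x o) := by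
    intro o ho
    rw [mem_L]
    have := M.t x p o
    have := M.t x y o
    omega
  have m2 : ∀ o, 4 ≤ d x o + d y o → (o ∉ L d y q ↔ d o q = d y o) := by
    intro o ho
    rw [mem_L]
    have := M.t y q o
    have := M.t x y o
    omega
  have m3 : ∀ o, 4 ≤ d x o + d y o → (o ∉ L d p q ↔ d o p = d o q) := by
    intro o ho
    rw [mem_L]
    have := M.t p q o
    have := M.t x p o
    have := M.t y p o
    have := M.t x q o
    have := M.t y q o
    omega
  by_cases ca : ∃ o, 4 ≤ d x o + d y o ∧ o ∉ L d x p ∧ o ∉ L d y q ∧ o ∉ L d p q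
  · obtain ⟨o, ho, ho1, ho2, ho3⟩ := ca
    rw [m1 o ho] at ho1
    rw [m2 o ho] at ho2
    rw [m3 o ho] at ho3
    have N1 := NL2 M hp (by omega) (by omega) ho1
    have N2 := NL2 M hq (o := o) (by omega) (by omega) ho2
    rw [IL_comm] at N2
    have hn : L d o p ≠ L d o q := by
      intro e
      have e2 := ext_L e q
      have t := M.t o p q
      omega
    have hs : ∃ s ∈ IL d x y, x ∈ s ∧ L d x y ≠ s := by
      by_cases g1 : L d x y = L d x p
      swap
      · exact ⟨_, l1.2.2.2, l1.1, g1⟩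
      by_cases g2 : L d x y = L d y q
      swap
      · exact ⟨_, l2.2.2.2, l2.1, g2⟩
      by_cases g3 : L d x y = L d p q
      swap
      · exact ⟨_, l3, l3x, g3⟩
      exfalso
      have dat : ∀ o, 4 ≤ d x o + d y o → d o p = d x o ∧ d o q = d y o ∧ d o p = d o q := by
        intro o ho
        have i1 := I_out M hxy ho
        exact ⟨(m1 o ho).1 (g1 ▸ i1), (m2 o ho).1 (g2 ▸ i1), (m3 o ho).1 (g3 ▸ i1)⟩
      have no2 : ∀ o, 4 ≤ d x o + d y o → d x o ≠ 2 := by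
        intro o ho h2
        obtain ⟨c, hc1, hc2⟩ := M.step2 x o h2
        have h1 := dat c
        have h3 := dat o ho
        have t := M.t x y c
        have : c = p := hP c ⟨hc1, by omega⟩
        subst this
        have t3 := M.t c o o
        omega
      have h0 := no2 o ho
      have t := M.t x y o
      obtain ⟨c, hc1, hc2⟩ := M.step3 x o (by omega)
      have h1 := no2 c
      have t := M.t x y c
      have : c = q := hQ c ⟨by omega, hc1⟩
      subst this
      have t3 := M.t c o o
      omega
    obtain ⟨s, hs1, hs2, hs3⟩ := hs
    refine C4 (L d x y) s _ _ hI hs1 N1.1 N2.1 hs3 ?_ ?_ ?_ ?_ hn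
    · intro e; exact N1.2.1 (e ▸ (I_mem M).1)
    · intro e; exact N1.2.1 (e ▸ hs2)
    · intro e; exact N2.2.2 (e ▸ (I_mem M).1)
    · intro e; exact N2.2.2 (e ▸ hs2)
  have ca' : ∀ o, 4 ≤ d x o + d y o → ∃ s ∈ IL d x y, o ∈ s ∧ x ∈ s ∧ y ∈ s ∧ p ∈ s ∧ q ∈ s ∧
      ∃ z, z ∉ s := by
    intro o ho
    by_cases g1 : o ∈ L d x p
    · exact ⟨_, l1.2.2.2, g1, l1.1, l1.2.1, l1.2.2.1, l1q, hu _ _ (by omega)⟩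
    by_cases g2 : o ∈ L d y q
    · exact ⟨_, l2.2.2.2, g2, l2.1, l2.2.1, l2p, l2.2.2.1, hu _ _ (by omega)⟩
    by_cases g3 : o ∈ L d p q
    · exact ⟨_, l3, g3, l3x, l3y, l3p, l3q, hu _ _ (by omega)⟩
    exact absurd ⟨o, ho, g1, g2, g3⟩ ca
  -- covering criterion
  have cov : ∀ s : Set V, x ∈ s → y ∈ s → p ∈ s → q ∈ s → (∃ z, z ∉ s) →
      ∃ o, 4 ≤ d x o + d y o ∧ o ∉ s := by
    rintro s hx hy hp' hq' ⟨z, hz⟩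
    by_contra hc
    push Not at hc
    exact hz (cover M hxy hp hq hx hy (fun a ha => hP a ha ▸ hp') (fun a ha => hQ a ha ▸ hq') hc z)
  obtain ⟨o, ho⟩ := hne
  obtain ⟨s, hs, hso, hsx, hsy, hsp, hsq, hsz⟩ := ca' o ho
  obtain ⟨o', ho', hso'⟩ := cov s hsx hsy hsp hsq hsz
  obtain ⟨s', hs', hso2, hsx', -, -, -, -⟩ := ca' o' ho'
  have n1 : L d x y ≠ s := by
    rintro rfl; exact I_out M hxy ho hso
  have n2 : L d x y ≠ s' := by
    rintro rfl; exact I_out M hxy ho' hso2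
  have n3 : s ≠ s' := by
    rintro rfl; exact hso' hso2
  by_cases hE : EE d x y
  · exact C3 _ _ _ hI hs hs' n1 n2 n3 hE
  by_cases hN : ∃ l ∈ IL d x y, x ∉ l ∧ y ∉ l
  · obtain ⟨l, hl, hlx, hly⟩ := hN
    refine C4 _ _ _ l hI hs hs' hl n1 n2 n3 ?_ ?_ ?_
    · rintro rfl; exact hlx (I_mem M).1
    · rintro rfl; exact hlx hsx
    · rintro rfl; exact hlx hsx'
  have hN : NoN d x y := hN
  have hK : ∃ o, 4 ≤ d x o + d y o ∧ 2 ≤ d x o ∧ 2 ≤ d y o := by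
    by_contra hc
    push Not at hc
    refine hE (EE_of_K M hxy ?_)
    intro o h1 h2 h3
    have := hc o h1 h2
    omega
  obtain ⟨k, hk, hk1, hk2⟩ := hK
  have mk := I_out M hxy hk
  have i1 : L d x y ≠ L d x p := fun e => mk (e ▸ hN.op M hp hk1 hk2)
  have i2 : L d x y ≠ L d y q := fun e => mk (e ▸ hN.swap.op M hq hk2 hk1)
  have i12 : L d x p ≠ L d y q := by
    intro e
    obtain ⟨z, hz⟩ := hu x p (by omega)
    exact hz (universal_of_eq M hxy hp hq adj hN e z)
  have i3 : L d x y ≠ L d p q := by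
    intro e
    obtain ⟨o, ho, hos⟩ := cov (L d x p) l1.1 l1.2.1 l1.2.2.1 l1q (hu _ _ (by omega))
    have hos' := (m1 o ho).1 hos
    have h3 := (m3 o ho).1 (e ▸ I_out M hxy ho)
    have h4 : ¬ (2 ≤ d x o ∧ 2 ≤ d y o) := fun h => hos (hN.op M hp h.1 h.2)
    have := M.t x y o
    have := M.t x p o
    have := M.t y p o
    have := M.t x q o
    have := M.t y q o
    omega
  have noK : (∀ o, 2 ≤ d x o → 2 ≤ d y o → o ∈ L d p q) → False := by
    intro hc
    apply hE
    have dat : ∀ o, 2 ≤ d x o → 2 ≤ d y o → d o p ≠ d x o ∧ d o q ≠ d y o ∧ d o p ≠ d o q := by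
      intro o h1 h2
      have ho : 4 ≤ d x o + d y o := by omega
      refine ⟨fun e => ?_, fun e => ?_, fun e => ?_⟩
      · exact (m1 o ho).2 e (hN.op M hp h1 h2)
      · exact (m2 o ho).2 e (hN.swap.op M hq h2 h1)
      · exact (m3 o ho).2 e (hc o h1 h2)
    refine Or.inr (Or.inr (Or.inl ⟨?_, ?_⟩))
    · intro o ho e
      have := dat o (by omega) (by omega)
      have := M.t p q o
      have := M.t x p o
      have := M.t y q o
      omega
    · intro v h1 h2
      have := dat v (by omega) (by omega)
      exact ⟨q, f4, f3, by omega⟩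
  refine C4 _ _ _ _ hI l1.2.2.2 l2.2.2.2 l3 i1 i2 i12 i3 ?_ ?_
  · intro e
    exact noK fun o h1 h2 => e ▸ hN.op M hp h1 h2
  · intro e
    exact noK fun o h1 h2 => e ▸ hN.swap.op M hq h2 h1

theorem inner_goal [Finite V] (M : Met d) {x y : V} (hxy : d x y = 3)
    (hu : ∀ a b, d a b ≠ 0 → ∃ z, z ∉ L d a b)
    (hne : ∃ o, 4 ≤ d x o + d y o) : Goal d x y := by
  have hyx : d y x = 3 := M.symm x y ▸ hxy
  have hne' : ∃ o, 4 ≤ d y o + d x o := by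
    obtain ⟨o, ho⟩ := hne
    exact ⟨o, by omega⟩
  by_cases h1 : ∀ p ∈ P d x y, ∃ p' ∈ P d x y, p' ≠ p
  · by_cases h2 : ∀ p ∈ P d y x, ∃ p' ∈ P d y x, p' ≠ p
    · exact caseI M hxy hne h1 h2
    · push Not at h2
      obtain ⟨q, hq, hQ⟩ := h2
      exact (caseII M hyx hu hne' hq hQ h1).swap
  · push Not at h1
    obtain ⟨p, hp, hP⟩ := h1
    by_cases h2 : ∀ p ∈ P d y x, ∃ p' ∈ P d y x, p' ≠ p
    · exact caseII M hxy hu hne hp hP h2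
    · push Not at h2
      obtain ⟨q, hq, hQ⟩ := h2
      exact caseIII M hxy hu hne hp hP hq hQ

theorem total [Fintype V] (M : Met d) {x y : V} (hxy : d x y = 3)
    (hu : ∀ a b, d a b ≠ 0 → ∃ z, z ∉ L d a b) : Fintype.card V ≤ (Lines d).ncard := by
  classical
  have hne : ∃ o, 4 ≤ d x o + d y o := by
    obtain ⟨z, hz⟩ := hu x y (by omega)
    refine ⟨z, ?_⟩
    rw [mem_L] at hz
    have := M.t x y z
    omega
  have hsplit : (Lines d).ncard = (NI d x y).ncard + (IL d x y).ncard := by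
    rw [← Set.ncard_union_eq _ (Set.toFinite _) (Set.toFinite _)]
    · congr 1
      ext l
      change l ∈ Lines d ↔ (l ∈ Lines d ∧ ¬ Inner d x y l) ∨ (l ∈ Lines d ∧ Inner d x y l)
      tauto
    · rw [Set.disjoint_left]
      intro l h1 h2
      exact h1.2 h2.2
  have hcard : Fintype.card V ≤ (Out d x y).ncard + (P d x y).ncard + (P d y x).ncard + 2 := by
    have huniv : (Set.univ : Set V) ⊆ ((Out d x y ∪ P d x y) ∪ P d y x) ∪ {x, y} := by
      intro z _
      have t := M.t x y z
      by_cases h0 : d x z = 0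
      · right; left; exact (M.eq0 _ _ h0).symm
      by_cases h1 : d y z = 0
      · right; right; exact (M.eq0 _ _ h1).symm
      left
      by_cases h2 : 4 ≤ d x z + d y z
      · left; left; exact h2
      by_cases h3 : d x z = 1
      · left; right; exact ⟨h3, by omega⟩
      · right; exact ⟨by omega, by omega⟩
    have h1 := Set.ncard_le_ncard huniv (Set.toFinite _)
    rw [Set.ncard_univ, Nat.card_eq_fintype_card] at h1
    have h2 := Set.ncard_union_le ((Out d x y ∪ P d x y) ∪ P d y x) {x, y}
    have h3 := Set.ncard_union_le (Out d x y ∪ P d x y) (P d y x)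
    have h4 := Set.ncard_union_le (Out d x y) (P d x y)
    have h5 := Set.ncard_insert_le x {y}
    rw [Set.ncard_singleton] at h5
    omega
  rcases inner_goal M hxy hu hne with h | ⟨h, hE⟩
  · have := outer M hxy
    omega
  · have := outer_plus M hxy hne hE
    omega

theorem met_of_graph (G : SimpleGraph V) (hconn : G.Connected)
    (hdiam : ∀ a b : V, G.dist a b ≤ 3) : Met G.dist := by
  have step : ∀ (k : ℕ) (a b : V), G.dist a b = k + 1 → ∃ c, G.dist a c = k ∧ G.dist c b = 1 := by
    intro k a b h
    obtain ⟨w, hw⟩ := hconn.exists_walk_length_eq_dist b a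
    rw [SimpleGraph.dist_comm, h] at hw
    cases w with
    | nil => simp at hw
    | @cons _ c _ hadj w' =>
      have h1 : G.dist c a ≤ k := by
        have := SimpleGraph.dist_le w'
        simp at hw
        omega
      have h2 : G.dist c b = 1 := SimpleGraph.dist_eq_one_iff_adj.2 hadj.symm
      have h3 := hconn.dist_triangle (u := a) (v := c) (w := b)
      rw [SimpleGraph.dist_comm] at h1
      exact ⟨c, by omega, h2⟩
  exact {
    self := fun a => SimpleGraph.dist_self
    eq0 := fun a b h => hconn.dist_eq_zero_iff.1 h
    symm := fun a b => SimpleGraph.dist_comm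
    tri := fun a b c => hconn.dist_triangle
    le3 := hdiam
    step2 := fun a b h => step 1 a b h
    step3 := fun a b h => step 2 a b h }

end

end CC

/-- Graphs of diameter three satisfy the Chen–Chvátal conjecture. -/
theorem stmt_14 {V : Type*} [Fintype V] (G : SimpleGraph V) (hconn : G.Connected)
    (hdiam : ∀ a b : V, G.dist a b ≤ 3) (hex : ∃ a b : V, G.dist a b = 3)
    (huniv : ∀ x y : V, x ≠ y → graphLine G x y ≠ Set.univ) :
    Fintype.card V ≤ (graphLines G).ncard := by
  have M := CC.met_of_graph G hconn hdiam
  obtain ⟨a, b, hab⟩ := hex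
  have hL : ∀ x y, graphLine G x y = CC.L G.dist x y := by
    intro x y
    ext z
    simp only [graphLine, CC.L, Set.mem_union, Set.mem_insert_iff, Set.mem_singleton_iff]
    constructor
    · rintro ((rfl | rfl) | h)
      · right; left; simp
      · right; left; simp
      · exact h
    · intro h
      exact Or.inr h
  have hLs : graphLines G = CC.Lines G.dist := by
    ext l
    constructor
    · rintro ⟨x, y, h, rfl⟩
      exact ⟨x, y, h, hL x y⟩
    · rintro ⟨x, y, h, rfl⟩
      exact ⟨x, y, h, (hL x y).symm⟩
  rw [hLs]
  refine CC.total M hab ?_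
  intro x y hxy
  by_contra hc
  push Not at hc
  refine huniv x y ?_ ?_
  · rintro rfl
    exact hxy (M.self x)
  · rw [hL]
    exact Set.eq_univ_of_forall hc
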